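/- arXiv:1505.05037 — 5 statements merged into one kernel-verified Lean document; each statement's English description precedes it below -/
import Mathlib

section
/- There exists ρ₀ > 0 (depending only on d, a₁,…,a_d, α, p₁ and c₁, c₂) with the following property. Let ρ ≥ ρ₀, let δ ∈ Γ/2 be minimal in its direction (i.e. (Γ/2) ∩ ℝδ = ℤδ), and let γ ∈ ℝ^d satisfy: (i) c₁ρ ≤ |γ| ≤ c₂ρ; (ii) γ ∈ V_δ(ρ^{α₁}); (iii) γ ∉ V_a(ρ^{α₂}) for every a ∈ Γ(p₁ρ^α) with a ∉ ℝδ. Then for all integers n, s′ with |nδ| < (1/2)ρ^{α₂/2} + p₁ρ^α and |s′δ| < (1/2)ρ^{α₂/2}, and every a ∈ Γ(p₁ρ^α) with a ∉ ℝδ, one has | |γ + s′δ + a|² − |γ + nδ|² | ≥ ρ^{α₂}/3. -/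
noncomputable section

/-- The lattice `Γ/2 = {(n₁π/(2a₁),…,n_dπ/(2a_d)) : n ∈ ℤ^d}`. -/
def halfLattice {d : ℕ} (a : Fin d → ℝ) : Set (EuclideanSpace ℝ (Fin d)) :=
  {x | ∃ n : Fin d → ℤ, ∀ i, x i = (n i : ℝ) * Real.pi / (2 * a i)}

/-- `Γ(r) = {b ∈ Γ/2 : 0 < |b| < r}`. -/
def latticeBall {d : ℕ} (a : Fin d → ℝ) (r : ℝ) : Set (EuclideanSpace ℝ (Fin d)) :=
  {b | b ∈ halfLattice a ∧ 0 < ‖b‖ ∧ ‖b‖ < r}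

/-- The resonance domain `V_b(M) = {x : | ‖x‖² − ‖x+b‖² | < M}`. -/
def resDomain {d : ℕ} (b : EuclideanSpace ℝ (Fin d)) (M : ℝ) : Set (EuclideanSpace ℝ (Fin d)) :=
  {x | |‖x‖ ^ 2 - ‖x + b‖ ^ 2| < M}

/-- Nonzero vectors of the lattice `Γ/2` have length at least `π / (2 ∑ aᵢ)`. -/
theorem le_norm_of_mem_halfLattice {d : ℕ} {a : Fin d → ℝ} (ha : ∀ i, 0 < a i)
    {x : EuclideanSpace ℝ (Fin d)} (hx : x ∈ halfLattice a) (hx0 : x ≠ 0) :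
    Real.pi / (2 * ∑ i, a i) ≤ ‖x‖ := by
  obtain ⟨n, hn⟩ := hx
  obtain ⟨i, hi⟩ : ∃ i, x i ≠ 0 := by
    by_contra! h
    exact hx0 (by ext i; simpa using h i)
  have hni : n i ≠ 0 := by
    rintro h
    exact hi (by simp [hn i, h])
  have hni' : (1 : ℝ) ≤ |(n i : ℝ)| := by exact_mod_cast Int.one_le_abs hni
  have hai := ha i
  calc Real.pi / (2 * ∑ i, a i) ≤ Real.pi / (2 * a i) := by
        have := Finset.single_le_sum (f := a) (fun j _ => (ha j).le) (Finset.mem_univ i)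
        have := Real.pi_pos
        gcongr
    _ ≤ |(n i : ℝ)| * (Real.pi / (2 * a i)) :=
        le_mul_of_one_le_left (by positivity) hni'
    _ = ‖x i‖ := by
        rw [hn i, Real.norm_eq_abs, mul_div_assoc, abs_mul,
          abs_of_pos (show 0 < Real.pi / (2 * a i) by positivity)]
    _ ≤ ‖x‖ := PiLp.norm_apply_le x i

/-- The squared length changes along `γ + mδ` by `m(m-1)|δ|²` up to a multiple of the change
at `m = 1`. -/
theorem norm_add_smul_sq_sub {E : Type*} [NormedAddCommGroup E] [InnerProductSpace ℝ E]
    (γ δ w : E) (s n : ℝ) :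
    ‖γ + s • δ + w‖ ^ 2 - ‖γ + n • δ‖ ^ 2 =
      -(‖γ‖ ^ 2 - ‖γ + w‖ ^ 2) - s * (‖γ‖ ^ 2 - ‖γ + δ‖ ^ 2) + n * (‖γ‖ ^ 2 - ‖γ + δ‖ ^ 2)
        + (s ^ 2 - s) * ‖δ‖ ^ 2 - (n ^ 2 - n) * ‖δ‖ ^ 2 + 2 * inner ℝ (s • δ) w := by
  simp only [norm_add_sq_real, inner_add_left, inner_smul_left, inner_smul_right, norm_smul,
    mul_pow, Real.norm_eq_abs, sq_abs, conj_trivial]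
  ring

/-- For an integer `m`, the number `m(m-1)` lies between `0` and `2m²`. -/
theorem Int.cast_sq_sub_self_mem_Icc (m : ℤ) :
    (m : ℝ) ^ 2 - m ∈ Set.Icc 0 (2 * (m : ℝ) ^ 2) := by
  have h : -(m ^ 2) ≤ m ∧ m ≤ m ^ 2 := ⟨by nlinarith [Int.le_self_sq (-m)], Int.le_self_sq m⟩
  have h1 : -((m : ℝ) ^ 2) ≤ m := by exact_mod_cast h.1
  have h2 : (m : ℝ) ≤ (m : ℝ) ^ 2 := by exact_mod_cast h.2
  constructor <;> linarith

/-- The separation estimate with `t = ρ^{α/2}`. -/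
theorem separation_of_resonance {E : Type*} [NormedAddCommGroup E] [InnerProductSpace ℝ E]
    {c p t : ℝ} (hc : 0 < c) (hp : 0 ≤ p) (ht1 : 1 ≤ t)
    (ht : 6 * (1 / c + p / c + 3 * p + 2 * p ^ 2) ≤ t) {γ δ w : E} (hδ : c ≤ ‖δ‖)
    (hγδ : |‖γ‖ ^ 2 - ‖γ + δ‖ ^ 2| ≤ t ^ 6) (hγw : t ^ 18 ≤ |‖γ‖ ^ 2 - ‖γ + w‖ ^ 2|)
    (hw : ‖w‖ ≤ p * t ^ 2) {n s : ℤ} (hn : ‖(n : ℝ) • δ‖ ≤ 1 / 2 * t ^ 9 + p * t ^ 2)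
    (hs : ‖(s : ℝ) • δ‖ ≤ 1 / 2 * t ^ 9) :
    t ^ 18 / 3 ≤ |‖γ + (s : ℝ) • δ + w‖ ^ 2 - ‖γ + (n : ℝ) • δ‖ ^ 2| := by
  have t0 : 0 ≤ t := by linarith
  have coeff_bound : ∀ (m : ℤ) (B : ℝ), ‖(m : ℝ) • δ‖ ≤ B →
      |m * (‖γ‖ ^ 2 - ‖γ + δ‖ ^ 2)| ≤ B / c * t ^ 6 ∧
      0 ≤ ((m : ℝ) ^ 2 - m) * ‖δ‖ ^ 2 ∧ ((m : ℝ) ^ 2 - m) * ‖δ‖ ^ 2 ≤ 2 * B ^ 2 := by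
    intro m B hB
    obtain ⟨h0, h2⟩ := Int.cast_sq_sub_self_mem_Icc m
    have hsq : ‖(m : ℝ) • δ‖ ^ 2 ≤ B ^ 2 := by gcongr
    rw [norm_smul, mul_pow, Real.norm_eq_abs, sq_abs] at hsq
    rw [norm_smul, Real.norm_eq_abs] at hB
    refine ⟨?_, by positivity, ?_⟩
    · have hm : |(m : ℝ)| ≤ B / c := by
        rw [le_div_iff₀ hc]
        exact (mul_le_mul_of_nonneg_left hδ (abs_nonneg _)).trans hB
      rw [abs_mul]
      exact mul_le_mul hm hγδ (abs_nonneg _) ((abs_nonneg _).trans hm)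
    · calc _ ≤ 2 * (m : ℝ) ^ 2 * ‖δ‖ ^ 2 := by gcongr
        _ ≤ 2 * B ^ 2 := by linarith
  obtain ⟨s1, s2, s3⟩ := coeff_bound s _ hs
  obtain ⟨n1, n2, n3⟩ := coeff_bound n _ hn
  have hin : |inner ℝ ((s : ℝ) • δ) w| ≤ 1 / 2 * t ^ 9 * (p * t ^ 2) :=
    (abs_real_inner_le_norm _ _).trans (by gcongr)
  have herr : (1 / 2 * t ^ 9) / c * t ^ 6 + (1 / 2 * t ^ 9 + p * t ^ 2) / c * t ^ 6
      + 2 * (1 / 2 * t ^ 9 + p * t ^ 2) ^ 2 + 2 * (1 / 2 * t ^ 9 * (p * t ^ 2))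
      ≤ t ^ 18 / 2 + t ^ 18 / 6 := by
    calc _ = t ^ 18 / 2 + (1 / c * t ^ 15 + p / c * t ^ 8 + 3 * p * t ^ 11
          + 2 * p ^ 2 * t ^ 4) := by field_simp; ring
      _ ≤ t ^ 18 / 2 + (1 / c * t ^ 17 + p / c * t ^ 17 + 3 * p * t ^ 17
          + 2 * p ^ 2 * t ^ 17) := by gcongr <;> first | exact ht1 | norm_num
      _ = t ^ 18 / 2 + 6 * (1 / c + p / c + 3 * p + 2 * p ^ 2) * t ^ 17 / 6 := by ring
      _ ≤ t ^ 18 / 2 + t * t ^ 17 / 6 := by gcongr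
      _ = _ := by ring
  have hs3 : 2 * (1 / 2 * t ^ 9) ^ 2 ≤ 2 * (1 / 2 * t ^ 9 + p * t ^ 2) ^ 2 := by
    have : 0 ≤ p * t ^ 2 := by positivity
    gcongr
    linarith
  rw [norm_add_smul_sq_sub]
  rw [abs_le] at s1 n1 hin
  rcases le_abs.mp hγw with h | h
  · exact le_abs.mpr (Or.inr (by linarith))
  · exact le_abs.mpr (Or.inl (by linarith))

/-- STATEMENT 2 (inequality (26) in the proof of Lemma 2.1), with `α₁ = 3α`, `α₂ = 9α`. -/
theorem stmt2 (d : ℕ) (hd : 2 ≤ d) (a : Fin d → ℝ) (ha : ∀ i, 0 < a i)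
    (α : ℝ) (hα0 : 0 < α) (hα1 : α < 1 / ((d : ℝ) + 20))
    (p₁ : ℕ) (hp₁ : 0 < p₁) (c₁ c₂ : ℝ) (hc₁ : 0 < c₁) (hc₂ : 0 < c₂) :
    ∃ ρ₀ > (0 : ℝ), ∀ ρ : ℝ, ρ₀ ≤ ρ →
      -- δ ∈ Γ/2, minimal in its direction: (Γ/2) ∩ ℝδ = ℤδ
      ∀ δ : EuclideanSpace ℝ (Fin d), δ ∈ halfLattice a → δ ≠ 0 →
        (∀ x ∈ halfLattice a, (∃ t : ℝ, x = t • δ) → ∃ n : ℤ, x = (n : ℝ) • δ) →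
      ∀ γ : EuclideanSpace ℝ (Fin d),
        -- (i) c₁ρ ≤ |γ| ≤ c₂ρ
        c₁ * ρ ≤ ‖γ‖ → ‖γ‖ ≤ c₂ * ρ →
        -- (ii) γ ∈ V_δ(ρ^{α₁})
        γ ∈ resDomain δ (ρ ^ (3 * α)) →
        -- (iii) γ ∉ V_w(ρ^{α₂}) for every w ∈ Γ(p₁ρ^α) with w ∉ ℝδ
        (∀ w ∈ latticeBall a ((p₁ : ℝ) * ρ ^ α), (¬∃ t : ℝ, w = t • δ) →
          γ ∉ resDomain w (ρ ^ (9 * α))) →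
      ∀ n s' : ℤ,
        ‖(n : ℝ) • δ‖ < (1 / 2) * ρ ^ (9 * α / 2) + (p₁ : ℝ) * ρ ^ α →
        ‖(s' : ℝ) • δ‖ < (1 / 2) * ρ ^ (9 * α / 2) →
      ∀ w ∈ latticeBall a ((p₁ : ℝ) * ρ ^ α), (¬∃ t : ℝ, w = t • δ) →
        ρ ^ (9 * α) / 3 ≤
          |‖γ + (s' : ℝ) • δ + w‖ ^ 2 - ‖γ + (n : ℝ) • δ‖ ^ 2| := by
  have : NeZero d := ⟨by omega⟩
  have hsum : 0 < ∑ i, a i := Finset.sum_pos (fun i _ => ha i) Finset.univ_nonempty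
  have hpi := Real.pi_pos
  set c := Real.pi / (2 * ∑ i, a i)
  have hc : 0 < c := by positivity
  set K := 6 * (1 / c + p₁ / c + 3 * p₁ + 2 * (p₁ : ℝ) ^ 2)
  have hK0 : 0 ≤ K := by positivity
  refine ⟨(K + 1) ^ (2 / α), by positivity, ?_⟩
  intro ρ hρ δ hδ hδ0 _ γ _ _ hγδ hγw n s hn hs w hw hwδ
  have hρ0 : 0 < ρ := lt_of_lt_of_le (by positivity) hρ
  have htK : K + 1 ≤ ρ ^ (α / 2) := by
    calc K + 1 = ((K + 1) ^ (2 / α)) ^ (α / 2) := by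
          rw [← Real.rpow_mul (by positivity)]
          field_simp
          simp
      _ ≤ ρ ^ (α / 2) := by gcongr
  have hpow : ∀ k : ℕ, (ρ ^ (α / 2)) ^ k = ρ ^ (α / 2 * k) := fun k => by
    rw [Real.rpow_mul hρ0.le, Real.rpow_natCast]
  have e2 : ρ ^ α = (ρ ^ (α / 2)) ^ 2 := by rw [hpow]; congr 1; push_cast; ring
  have e6 : ρ ^ (3 * α) = (ρ ^ (α / 2)) ^ 6 := by rw [hpow]; congr 1; push_cast; ring
  have e9 : ρ ^ (9 * α / 2) = (ρ ^ (α / 2)) ^ 9 := by rw [hpow]; congr 1; push_cast; ring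
  have e18 : ρ ^ (9 * α) = (ρ ^ (α / 2)) ^ 18 := by rw [hpow]; congr 1; push_cast; ring
  have hγw : _ ≤ |‖γ‖ ^ 2 - ‖γ + w‖ ^ 2| := not_lt.mp (hγw w hw hwδ)
  have hγδ : |‖γ‖ ^ 2 - ‖γ + δ‖ ^ 2| < _ := hγδ
  have hw := hw.2.2
  rw [e18] at hγw ⊢
  rw [e6] at hγδ
  rw [e2] at hw
  rw [e9, e2] at hn
  rw [e9] at hs
  exact separation_of_resonance hc (Nat.cast_nonneg p₁) (by linarith) (by linarith)
    (le_norm_of_mem_halfLattice ha hδ hδ0) hγδ.le hγw hw.le hn.le hs.le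
end
end

section
/- There exist c > 0 and ρ₀ > 0 (depending only on d, m, a₁,…,a_d, α, p₁, M and c₁, c₂) with the following property. Let ρ ≥ ρ₀, let δ ∈ Γ/2 be minimal in its direction (i.e. (Γ/2) ∩ ℝδ = ℤδ), and let γ ∈ ℝ^d satisfy c₁ρ ≤ |γ| ≤ c₂ρ, γ ∈ V_δ(ρ^{α₁}), and γ ∉ V_a(ρ^{α₂}) for every a ∈ Γ(p₁ρ^α) with a ∉ ℝδ. Let h₁,…,h_{b₁} be an enumeration of B₁(γ,p₁) such that h₁,…,h_{a₁} are exactly the elements of B₁(γ,p₁) ∩ {γ + nδ : n ∈ ℤ}, let C = C(γ,δ) be the associated block matrix and D = D(γ,δ) its leading principal m·a₁ × m·a₁ submatrix. Then for every eigenvalue η of C satisfying |η − |h_s|²| < M for some s ∈ {1,…,a₁}, there exists an eigenvalue η̃ of D such that |η − η̃| ≤ c·ρ^{−(3/4)α₂}. -/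
open Matrix

noncomputable section

/-- `B₁(γ,p₁) = {γ + nδ + a : n ∈ ℤ, |nδ| < (1/2)ρ^{α₂/2}, a ∈ Γ(p₁ρ^α) ∪ {0}}` (α₂ = 9α). -/
def B1Set {d : ℕ} (a : Fin d → ℝ) (δ γ : EuclideanSpace ℝ (Fin d)) (ρ α : ℝ) (p₁ : ℕ) :
    Set (EuclideanSpace ℝ (Fin d)) :=
  {x | ∃ n : ℤ, ‖(n : ℝ) • δ‖ < (1 / 2) * ρ ^ (9 * α / 2) ∧
    ∃ w ∈ latticeBall a ((p₁ : ℝ) * ρ ^ α) ∪ {0}, x = γ + (n : ℝ) • δ + w}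

/-- The `m·b₁ × m·b₁` block matrix `C(γ,δ)` with diagonal blocks `|h_τ|² I_m` and off-diagonal
blocks `V_{h_τ − h_ξ}`. -/
def blockC {d m b₁ : ℕ} (V : EuclideanSpace ℝ (Fin d) → Matrix (Fin m) (Fin m) ℝ)
    (h : Fin b₁ → EuclideanSpace ℝ (Fin d)) :
    Matrix (Fin b₁ × Fin m) (Fin b₁ × Fin m) ℝ :=
  fun p q =>
    if p.1 = q.1 then (if p.2 = q.2 then ‖h p.1‖ ^ 2 else 0)
    else V (h p.1 - h q.1) p.2 q.2

/-- `η` is an eigenvalue of the square real matrix `A`. -/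
def Matrix.IsEigenvalueOf {n : Type*} [Fintype n] [DecidableEq n]
    (A : Matrix n n ℝ) (η : ℝ) : Prop :=
  ∃ x : n → ℝ, x ≠ 0 ∧ A.mulVec x = η • x

/-- A symmetric real matrix with an approximate eigenvector has an eigenvalue nearby. -/
lemma Matrix.exists_isEigenvalueOf_abs_sub_le {n : Type*} [Fintype n] [DecidableEq n]
    {A : Matrix n n ℝ} (hA : A.IsSymm) {x : n → ℝ} (hx : x ≠ 0) {η ε : ℝ} (hε : 0 ≤ ε)
    (h : ∑ i, ((A.mulVec x) i - η * x i) ^ 2 ≤ ε ^ 2 * ∑ i, x i ^ 2) :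
    ∃ η', A.IsEigenvalueOf η' ∧ |η - η'| ≤ ε := by
  have hH : A.IsHermitian := by
    rw [Matrix.IsHermitian, Matrix.conjTranspose_eq_transpose_of_trivial]; exact hA
  by_contra! hcon
  have hgap : ∀ i, ε < |η - hH.eigenvalues i| := fun i => by
    refine hcon _ ⟨hH.eigenvectorBasis i, fun h0 => ?_, ?_⟩
    · have h1 := hH.eigenvectorBasis.orthonormal.1 i
      rw [(by ext j; exact congrFun h0 j : hH.eigenvectorBasis i = 0)] at h1
      simp at h1
    · exact hH.mulVec_eigenvectorBasis i
  set X : EuclideanSpace ℝ n := WithLp.toLp 2 x with hX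
  set Y : EuclideanSpace ℝ n := WithLp.toLp 2 (A.mulVec x - η • x) with hY
  have hXn : ‖X‖ ^ 2 = ∑ i, x i ^ 2 := by
    simp [EuclideanSpace.norm_sq_eq, hX]
  have hYn : ‖Y‖ ^ 2 = ∑ i, ((A.mulVec x) i - η * x i) ^ 2 := by
    simp [EuclideanSpace.norm_sq_eq, hY]
  have hc : ∀ i, inner ℝ (hH.eigenvectorBasis i) Y
      = (hH.eigenvalues i - η) * inner ℝ (hH.eigenvectorBasis i) X := fun i => by
    have h2 : inner ℝ (hH.eigenvectorBasis i) X = (hH.eigenvectorBasis i : n → ℝ) ⬝ᵥ x := by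
      simp [hX, PiLp.inner_apply, dotProduct, mul_comm]
    have h1 : inner ℝ (hH.eigenvectorBasis i) Y
        = (hH.eigenvectorBasis i : n → ℝ) ⬝ᵥ (A.mulVec x - η • x) := by
      simp [hY, PiLp.inner_apply, dotProduct, mul_comm]
    have h3 := hH.mulVec_eigenvectorBasis i
    rw [h1, h2, dotProduct_sub, dotProduct_smul, dotProduct_mulVec, ← mulVec_transpose, hA.eq, h3,
      smul_dotProduct]
    simp only [smul_eq_mul]; ring
  have hXs := hH.eigenvectorBasis.sum_sq_norm_inner_right X
  have hYs := hH.eigenvectorBasis.sum_sq_norm_inner_right Y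
  have hX0 : X ≠ 0 := fun h0 => hx (by
    ext i; exact congrArg (fun z : EuclideanSpace ℝ n => z i) h0)
  have hXpos : 0 < ‖X‖ ^ 2 := by positivity
  have hle : ∀ i, ε ^ 2 * ‖inner ℝ (hH.eigenvectorBasis i) X‖ ^ 2
      ≤ ‖inner ℝ (hH.eigenvectorBasis i) Y‖ ^ 2 := fun i => by
    rw [hc, norm_mul, mul_pow, Real.norm_eq_abs (_ - _), abs_sub_comm]
    have := (hgap i).le
    gcongr
  obtain ⟨i, hi⟩ : ∃ i, inner ℝ (hH.eigenvectorBasis i) X ≠ 0 := by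
    by_contra! h0
    simp only [h0, norm_zero] at hXs
    norm_num at hXs
    linarith
  have hlt : ε ^ 2 * ‖X‖ ^ 2 < ‖Y‖ ^ 2 := by
    rw [← hXs, ← hYs, Finset.mul_sum]
    refine Finset.sum_lt_sum (fun j _ => hle j) ⟨i, Finset.mem_univ _, ?_⟩
    rw [hc, norm_mul, mul_pow, Real.norm_eq_abs (_ - _), abs_sub_comm]
    have := hgap i
    gcongr
  rw [hXn, hYn] at hlt
  linarith

/-- Schur's test for finite families of operators. -/
lemma sum_sq_norm_sum_clm_le {ι κ E F : Type*} [Fintype ι] [Fintype κ]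
    [NormedAddCommGroup E] [NormedSpace ℝ E] [NormedAddCommGroup F] [NormedSpace ℝ F]
    (T : ι → κ → E →L[ℝ] F) {M : ℝ} (hM : 0 ≤ M)
    (hrow : ∀ i, ∑ k, ‖T i k‖ ≤ M) (hcol : ∀ k, ∑ i, ‖T i k‖ ≤ M) (v : κ → E) :
    ∑ i, ‖∑ k, T i k (v k)‖ ^ 2 ≤ M ^ 2 * ∑ k, ‖v k‖ ^ 2 := by
  have h1 : ∀ i, ‖∑ k, T i k (v k)‖ ^ 2 ≤ M * ∑ k, ‖T i k‖ * ‖v k‖ ^ 2 := fun i => by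
    have ha : ‖∑ k, T i k (v k)‖ ≤ ∑ k, ‖T i k‖ * ‖v k‖ :=
      (norm_sum_le _ _).trans (Finset.sum_le_sum fun k _ => (T i k).le_opNorm _)
    have hb : (∑ k, ‖T i k‖ * ‖v k‖) ^ 2 ≤ (∑ k, ‖T i k‖) * ∑ k, ‖T i k‖ * ‖v k‖ ^ 2 :=
      Finset.sum_sq_le_sum_mul_sum_of_sq_le_mul _ (fun k _ => by positivity)
        (fun k _ => by positivity) (fun k _ => by ring_nf; rfl)
    calc _ ≤ (∑ k, ‖T i k‖ * ‖v k‖) ^ 2 := by gcongr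
      _ ≤ _ := hb
      _ ≤ _ := mul_le_mul_of_nonneg_right (hrow i) (Finset.sum_nonneg fun k _ => by positivity)
  calc _ ≤ ∑ i, M * ∑ k, ‖T i k‖ * ‖v k‖ ^ 2 := Finset.sum_le_sum fun i _ => h1 i
    _ = M * ∑ k, (∑ i, ‖T i k‖) * ‖v k‖ ^ 2 := by
      rw [← Finset.mul_sum, Finset.sum_comm]; simp only [Finset.sum_mul]
    _ ≤ M * ∑ k, M * ‖v k‖ ^ 2 := by
      gcongr with k _
      exact hcol k
    _ = _ := by rw [← Finset.mul_sum]; ring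

/-- The off-diagonal blocks of `blockC`, as operators. -/
def offDiagBlock {d m b : ℕ} (V : EuclideanSpace ℝ (Fin d) → Matrix (Fin m) (Fin m) ℝ)
    (h : Fin b → EuclideanSpace ℝ (Fin d)) (τ ξ : Fin b) :
    EuclideanSpace ℝ (Fin m) →L[ℝ] EuclideanSpace ℝ (Fin m) :=
  if τ = ξ then 0 else Matrix.toEuclideanCLM (𝕜 := ℝ) (V (h τ - h ξ))

lemma blockC_mulVec_apply {d m b : ℕ} (V : EuclideanSpace ℝ (Fin d) → Matrix (Fin m) (Fin m) ℝ)
    (h : Fin b → EuclideanSpace ℝ (Fin d)) (x : Fin b × Fin m → ℝ) (τ : Fin b) (j : Fin m) :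
    (blockC V h).mulVec x (τ, j) = ‖h τ‖ ^ 2 * x (τ, j) +
      (∑ ξ, offDiagBlock V h τ ξ (WithLp.toLp 2 fun i => x (ξ, i))) j := by
  have h1 : ∀ ξ, ∑ i, blockC V h (τ, j) (ξ, i) * x (ξ, i)
      = (if τ = ξ then ‖h τ‖ ^ 2 * x (τ, j) else 0) +
        (offDiagBlock V h τ ξ (WithLp.toLp 2 fun i => x (ξ, i))) j := fun ξ => by
    by_cases hτ : τ = ξ
    · subst hτ
      simp [blockC, offDiagBlock]
    · simp [blockC, offDiagBlock, hτ, Matrix.toEuclideanCLM_toLp, mulVec, dotProduct]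
  rw [mulVec, dotProduct, Fintype.sum_prod_type]
  simp only [h1, Finset.sum_add_distrib]
  simp

/-- If the diagonal blocks of `blockC` outside a leading principal submatrix stay away from an
eigenvalue `η`, then the submatrix has an eigenvalue near `η`. -/
lemma exists_isEigenvalueOf_leading_blockC {d m a₁ r : ℕ}
    (V : EuclideanSpace ℝ (Fin d) → Matrix (Fin m) (Fin m) ℝ)
    (h : Fin (a₁ + r) → EuclideanSpace ℝ (Fin d)) {M L η : ℝ} (hM : 0 < M) (hL : 2 * M ≤ L)
    (hsymm : (blockC V fun i : Fin a₁ => h (Fin.castAdd r i)).IsSymm)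
    (hrow : ∀ τ, ∑ ξ, ‖offDiagBlock V h τ ξ‖ ≤ M) (hcol : ∀ ξ, ∑ τ, ‖offDiagBlock V h τ ξ‖ ≤ M)
    (hgap : ∀ k : Fin r, L ≤ |η - ‖h (Fin.natAdd a₁ k)‖ ^ 2|)
    (hη : (blockC V h).IsEigenvalueOf η) :
    ∃ η', (blockC V fun i : Fin a₁ => h (Fin.castAdd r i)).IsEigenvalueOf η' ∧
      |η - η'| ≤ 2 * M ^ 2 / L := by
  obtain ⟨x, hx0, hx⟩ := hη
  set v : Fin (a₁ + r) → EuclideanSpace ℝ (Fin m) := fun τ => WithLp.toLp 2 fun i => x (τ, i)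
    with hv
  have hLpos : 0 < L := by linarith
  have hact : ∀ τ, (η - ‖h τ‖ ^ 2) • v τ = ∑ ξ, offDiagBlock V h τ ξ (v ξ) := fun τ => by
    ext j
    have h1 := blockC_mulVec_apply V h x τ j
    rw [hx] at h1
    simp only [Pi.smul_apply, smul_eq_mul] at h1
    simp only [PiLp.smul_apply, smul_eq_mul, hv]
    linarith
  set X := ∑ i : Fin a₁, ‖v (Fin.castAdd r i)‖ ^ 2 with hX
  set Y := ∑ k : Fin r, ‖v (Fin.natAdd a₁ k)‖ ^ 2 with hY
  have hX0 : 0 ≤ X := Finset.sum_nonneg fun _ _ => by positivity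
  have hY0 : 0 ≤ Y := Finset.sum_nonneg fun _ _ => by positivity
  have hYX : L ^ 2 * Y ≤ M ^ 2 * (X + Y) := by
    have h1 := sum_sq_norm_sum_clm_le (offDiagBlock V h) hM.le hrow hcol v
    rw [Fin.sum_univ_add (fun ξ => ‖v ξ‖ ^ 2)] at h1
    refine le_trans ?_ h1
    rw [Fin.sum_univ_add, hY, Finset.mul_sum]
    refine le_add_of_nonneg_of_le (Finset.sum_nonneg fun _ _ => by positivity)
      (Finset.sum_le_sum fun k _ => ?_)
    rw [← hact, norm_smul, mul_pow, Real.norm_eq_abs]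
    have := hgap k
    gcongr
  have hYX' : L ^ 2 * Y ≤ 4 * M ^ 2 * X := by
    have h4 : (2 * M) ^ 2 ≤ L ^ 2 := by gcongr
    have h5 := mul_le_mul_of_nonneg_right h4 hY0
    have h6 : 0 ≤ M ^ 2 * X := by positivity
    nlinarith
  set x' : Fin a₁ × Fin m → ℝ := fun p => x (Fin.castAdd r p.1, p.2) with hx'
  have hXx : X = ∑ p, x' p ^ 2 := by
    rw [Fintype.sum_prod_type]
    simp [hX, hx', hv, EuclideanSpace.norm_sq_eq]
  have hx'0 : x' ≠ 0 := fun h0 => by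
    have hXz : X = 0 := by rw [hXx, h0]; simp
    have hYz : Y = 0 := by
      rw [hXz] at hYX'
      have : 0 < L ^ 2 := by positivity
      nlinarith
    refine hx0 (funext fun ⟨τ, j⟩ => ?_)
    induction τ using Fin.addCases with
    | left i => exact congrFun h0 (i, j)
    | right k =>
      have h1 := (Finset.sum_eq_zero_iff_of_nonneg fun _ _ => by positivity).1 hYz k
        (Finset.mem_univ _)
      have h2 : v (Fin.natAdd a₁ k) = 0 := by simpa using h1
      exact congrArg (fun z : EuclideanSpace ℝ (Fin m) => z j) h2
  have hres : ∀ i j, (blockC V fun i : Fin a₁ => h (Fin.castAdd r i)).mulVec x' (i, j)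
      - η * x' (i, j) = -(∑ k, offDiagBlock V h (Fin.castAdd r i) (Fin.natAdd a₁ k)
        (v (Fin.natAdd a₁ k))) j := fun i j => by
    have h1 := congrArg (fun z : EuclideanSpace ℝ (Fin m) => z j) (hact (Fin.castAdd r i))
    rw [blockC_mulVec_apply]
    have h2 : ∀ k, offDiagBlock V (fun i : Fin a₁ => h (Fin.castAdd r i)) i k
        = offDiagBlock V h (Fin.castAdd r i) (Fin.castAdd r k) := fun k => by
      simp [offDiagBlock]
    simp only [h2]
    rw [Fin.sum_univ_add] at h1
    simp only [PiLp.smul_apply, smul_eq_mul, PiLp.add_apply] at h1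
    simp only [hv, hx'] at h1 ⊢
    linarith
  refine Matrix.exists_isEigenvalueOf_abs_sub_le hsymm hx'0 (by positivity) ?_
  rw [← hXx, Fintype.sum_prod_type]
  simp only [hres, neg_sq]
  have hschur := sum_sq_norm_sum_clm_le
    (fun (i : Fin a₁) (k : Fin r) => offDiagBlock V h (Fin.castAdd r i) (Fin.natAdd a₁ k)) hM.le
    (fun i => by
      refine le_trans ?_ (hrow (Fin.castAdd r i))
      rw [Fin.sum_univ_add]
      exact le_add_of_nonneg_left (Finset.sum_nonneg fun _ _ => norm_nonneg _))
    (fun k => by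
      refine le_trans ?_ (hcol (Fin.natAdd a₁ k))
      rw [Fin.sum_univ_add]
      exact le_add_of_nonneg_right (Finset.sum_nonneg fun _ _ => norm_nonneg _))
    (fun k => v (Fin.natAdd a₁ k))
  simp only [EuclideanSpace.norm_sq_eq, Real.norm_eq_abs, sq_abs] at hschur
  refine hschur.trans ?_
  have hYe : (∑ k : Fin r, ∑ j, (v (Fin.natAdd a₁ k)) j ^ 2) = Y := by
    simp [hY, EuclideanSpace.norm_sq_eq]
  rw [hYe, div_pow, div_mul_eq_mul_div, le_div_iff₀ (by positivity)]
  nlinarith [mul_le_mul_of_nonneg_left hYX' (sq_nonneg M)]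

/-- Energies on the resonant line through `γ` are separated from energies off it. -/
lemma energy_gap {E : Type*} [NormedAddCommGroup E] [InnerProductSpace ℝ E] {δ γ w : E}
    {n k : ℤ} {κ p u : ℝ} (hκ : 0 < κ) (hκδ : κ ≤ ‖δ‖) (hp : 0 ≤ p) (hu : 1 ≤ u)
    (hγ : |‖γ‖ ^ 2 - ‖γ + δ‖ ^ 2| < u ^ 6) (hn : ‖(n : ℝ) • δ‖ < 1 / 2 * u ^ 9)
    (hw : ‖w‖ < p * u ^ 2) (hk : ‖(k : ℝ) • δ‖ < 1 / 2 * u ^ 9 + p * u ^ 2)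
    (hγw : u ^ 18 ≤ |‖γ‖ ^ 2 - ‖γ + w‖ ^ 2|) :
    1 / 2 * u ^ 18 - (3 * p + 2 * p ^ 2 + (1 + 2 * p) / κ) * u ^ 15
      ≤ |‖γ + (n : ℝ) • δ + w‖ ^ 2 - ‖γ + (k : ℝ) • δ‖ ^ 2| := by
  have hpu : u ^ 2 ≤ u ^ 9 := pow_le_pow_right₀ hu (by norm_num)
  set B := 1 / 2 * u ^ 9 + p * u ^ 2 with hB
  have hB0 : 0 ≤ B := by positivity
  have hline : ∀ l : ℤ, ‖(l : ℝ) • δ‖ < B →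
      ‖γ + (l : ℝ) • δ‖ ^ 2 - ‖γ‖ ^ 2 ≤ 2 * B ^ 2 + B / κ * u ^ 6 ∧
      -(B / κ * u ^ 6) ≤ ‖γ + (l : ℝ) • δ‖ ^ 2 - ‖γ‖ ^ 2 := fun l hl => by
    rw [norm_smul, Real.norm_eq_abs] at hl
    have hlκ : |(l : ℝ)| ≤ B / κ := by
      rw [le_div_iff₀ hκ]
      exact (mul_le_mul_of_nonneg_left hκδ (abs_nonneg _)).trans hl.le
    have hid : ‖γ + (l : ℝ) • δ‖ ^ 2 - ‖γ‖ ^ 2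
        = (l * (l - 1)) * ‖δ‖ ^ 2 - l * (‖γ‖ ^ 2 - ‖γ + δ‖ ^ 2) := by
      rw [norm_add_sq_real, norm_add_sq_real, inner_smul_right, norm_smul, mul_pow,
        Real.norm_eq_abs, sq_abs]
      ring
    have h1 : |(l : ℝ) * (‖γ‖ ^ 2 - ‖γ + δ‖ ^ 2)| ≤ B / κ * u ^ 6 := by
      rw [abs_mul]
      gcongr
    have h2 : (0 : ℝ) ≤ l * (l - 1) := by
      rcases le_or_gt l 0 with h | h
      · have : (l : ℝ) ≤ 0 := by exact_mod_cast h
        nlinarith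
      · have : (1 : ℝ) ≤ l := by exact_mod_cast h
        nlinarith
    have h3 : (l : ℝ) * (l - 1) ≤ 2 * |(l : ℝ)| ^ 2 := by
      rw [sq_abs]
      have h4 : 0 ≤ l * (l + 1) := by
        rcases le_or_gt 0 l with h | h
        · positivity
        · nlinarith
      have h5 : (0 : ℝ) ≤ l * (l + 1) := by exact_mod_cast h4
      linarith
    have h6 : (l * (l - 1)) * ‖δ‖ ^ 2 ≤ 2 * B ^ 2 := by
      calc (l * (l - 1)) * ‖δ‖ ^ 2 ≤ 2 * |(l : ℝ)| ^ 2 * ‖δ‖ ^ 2 := by gcongr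
        _ = 2 * (|(l : ℝ)| * ‖δ‖) ^ 2 := by ring
        _ ≤ _ := by gcongr
    have h7 := mul_nonneg h2 (sq_nonneg ‖δ‖)
    rw [hid]
    rw [abs_le] at h1
    constructor <;> linarith
  obtain ⟨hn1, hn2⟩ := hline n (hn.trans_le (le_add_of_nonneg_right (by positivity)))
  obtain ⟨hk1, hk2⟩ := hline k hk
  have hinner : |2 * inner ℝ ((n : ℝ) • δ) w| ≤ p * u ^ 11 := by
    rw [abs_mul, abs_two]
    have := (abs_real_inner_le_norm ((n : ℝ) • δ) w).trans
      (mul_le_mul hn.le hw.le (norm_nonneg _) (by positivity))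
    nlinarith
  have hid : ‖γ + (n : ℝ) • δ + w‖ ^ 2 - ‖γ + (k : ℝ) • δ‖ ^ 2
      = (‖γ + (n : ℝ) • δ‖ ^ 2 - ‖γ‖ ^ 2) - (‖γ + (k : ℝ) • δ‖ ^ 2 - ‖γ‖ ^ 2)
        - (‖γ‖ ^ 2 - ‖γ + w‖ ^ 2) + 2 * inner ℝ ((n : ℝ) • δ) w := by
    rw [norm_add_sq_real (γ + (n : ℝ) • δ) w, norm_add_sq_real γ w, inner_add_left]
    ring
  have hlow : 2 * B ^ 2 + 2 * (B / κ * u ^ 6) + p * u ^ 11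
      ≤ 1 / 2 * u ^ 18 + (3 * p + 2 * p ^ 2 + (1 + 2 * p) / κ) * u ^ 15 := by
    have e1 : 2 * B ^ 2 + p * u ^ 11 = 1 / 2 * u ^ 18 + 3 * p * u ^ 11 + 2 * p ^ 2 * u ^ 4 := by
      rw [hB]; ring
    have e2 : 2 * (B / κ * u ^ 6) ≤ (1 + 2 * p) / κ * u ^ 15 := by
      have : 2 * B ≤ (1 + 2 * p) * u ^ 9 := by rw [hB]; nlinarith
      calc 2 * (B / κ * u ^ 6) = (2 * B) / κ * u ^ 6 := by ring
        _ ≤ ((1 + 2 * p) * u ^ 9) / κ * u ^ 6 := by gcongr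
        _ = _ := by ring
    have e3 : 3 * p * u ^ 11 ≤ 3 * p * u ^ 15 := by gcongr; norm_num
    have e4 : 2 * p ^ 2 * u ^ 4 ≤ 2 * p ^ 2 * u ^ 15 := by gcongr; norm_num
    linarith
  rw [hid]
  rw [abs_le] at hinner
  rcases le_abs.1 hγw with h | h
  · refine le_trans ?_ (neg_le_abs _)
    linarith
  · refine le_trans ?_ (le_abs_self _)
    linarith

lemma halfLattice_sub_mem {d : ℕ} {a : Fin d → ℝ} {x y : EuclideanSpace ℝ (Fin d)}
    (hx : x ∈ halfLattice a) (hy : y ∈ halfLattice a) : x - y ∈ halfLattice a := by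
  obtain ⟨n, hn⟩ := hx
  obtain ⟨k, hk⟩ := hy
  exact ⟨n - k, fun i => by simp [hn, hk]; ring⟩

lemma halfLattice_zsmul_mem {d : ℕ} {a : Fin d → ℝ} {x : EuclideanSpace ℝ (Fin d)}
    (hx : x ∈ halfLattice a) (k : ℤ) : (k : ℝ) • x ∈ halfLattice a := by
  obtain ⟨n, hn⟩ := hx
  exact ⟨k • n, fun i => by simp [hn]; ring⟩

lemma halfLattice_add_mem {d : ℕ} {a : Fin d → ℝ} {x y : EuclideanSpace ℝ (Fin d)}
    (hx : x ∈ halfLattice a) (hy : y ∈ halfLattice a) : x + y ∈ halfLattice a := by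
  obtain ⟨n, hn⟩ := hx
  obtain ⟨k, hk⟩ := hy
  exact ⟨n + k, fun i => by simp [hn, hk]; ring⟩

/-- Nonzero vectors of `halfLattice a` are bounded away from `0`. -/
lemma exists_pos_le_norm_halfLattice {d : ℕ} (a : Fin d → ℝ) (ha : ∀ i, 0 < a i) :
    ∃ κ > (0 : ℝ), ∀ x ∈ halfLattice a, x ≠ 0 → κ ≤ ‖x‖ := by
  have hS : 0 ≤ ∑ i, a i := Finset.sum_nonneg fun i _ => (ha i).le
  refine ⟨Real.pi / (2 * (∑ i, a i + 1)), by positivity, ?_⟩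
  rintro x ⟨n, hn⟩ hx
  obtain ⟨i, hi⟩ : ∃ i, n i ≠ 0 := by
    by_contra! h0
    exact hx (by ext i; simp [hn, h0])
  have h1 : (1 : ℝ) ≤ |(n i : ℝ)| := by exact_mod_cast Int.one_le_abs hi
  have hai := ha i
  have h2 : a i ≤ ∑ i, a i + 1 :=
    (Finset.single_le_sum (fun j _ => (ha j).le) (Finset.mem_univ i)).trans (by linarith)
  calc Real.pi / (2 * (∑ i, a i + 1)) ≤ Real.pi / (2 * a i) := by gcongr
    _ ≤ |(n i : ℝ)| * (Real.pi / (2 * a i)) := le_mul_of_one_le_left (by positivity) h1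
    _ = ‖x i‖ := by
      rw [hn, Real.norm_eq_abs, mul_div_assoc, abs_mul, abs_of_pos (a := Real.pi / _)]
      positivity
    _ ≤ ‖x‖ := PiLp.norm_apply_le x i

/-- A row sum of off-diagonal block norms is at most the sum of all Fourier coefficient norms. -/
lemma sum_norm_comp_le_tsum {ι β : Type*} [Fintype ι] {S : Set β} {f : β → ℝ}
    (hf : ∀ b, 0 ≤ f b) (hs : Summable fun b : S => f b) {g : ι → β} (hg : Function.Injective g)
    (hgS : ∀ i, g i ∈ S) : ∑ i, f (g i) ≤ ∑' b : S, f b := by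
  have hinj : Function.Injective fun i => (⟨g i, hgS i⟩ : S) := fun i j hij =>
    hg (congrArg Subtype.val hij)
  have := hs.sum_le_tsum (Finset.univ.map ⟨_, hinj⟩) (fun b _ => hf b)
  simpa [Finset.sum_map] using this

lemma blockC_isSymm {d m b : ℕ} {V : EuclideanSpace ℝ (Fin d) → Matrix (Fin m) (Fin m) ℝ}
    {h : Fin b → EuclideanSpace ℝ (Fin d)}
    (hV : ∀ τ ξ, V (-(h τ - h ξ)) = (V (h τ - h ξ))ᵀ) : (blockC V h).IsSymm := by
  ext ⟨τ, i⟩ ⟨ξ, j⟩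
  simp only [blockC, Matrix.transpose_apply]
  by_cases hτ : τ = ξ
  · subst hτ
    simp [eq_comm]
  · rw [if_neg hτ, if_neg (Ne.symm hτ), ← neg_sub, hV, Matrix.transpose_apply]

/-- STATEMENT 4 (Theorem 2.2 of the paper), with `α₁ = 3α`, `α₂ = 9α`: every eigenvalue of
`C(γ,δ)` close to some `|h_s|²`, `s ≤ a₁`, is `O(ρ^{−(3/4)α₂})`-close to an eigenvalue of the
leading principal submatrix `D(γ,δ)`. -/
theorem stmt4 (d : ℕ) (hd : 2 ≤ d) (m : ℕ) (hm : 2 ≤ m)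
    (a : Fin d → ℝ) (ha : ∀ i, 0 < a i)
    (α : ℝ) (hα0 : 0 < α) (hα1 : α < 1 / ((d : ℝ) + 20))
    (p₁ : ℕ) (hp₁ : 0 < p₁) (M : ℝ) (hM : 0 < M)
    (c₁ c₂ : ℝ) (hc₁ : 0 < c₁) (hc₂ : 0 < c₂) :
    ∃ c > (0 : ℝ), ∃ ρ₀ > (0 : ℝ), ∀ ρ : ℝ, ρ₀ ≤ ρ →
      ∀ V : EuclideanSpace ℝ (Fin d) → Matrix (Fin m) (Fin m) ℝ,
        (∀ b ∈ halfLattice a, (V b).IsSymm) →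
        (∀ b ∈ halfLattice a, V (-b) = (V b)ᵀ) →
        Summable (fun b : halfLattice a => ‖Matrix.toEuclideanCLM (𝕜 := ℝ) (V b)‖) →
        (∑' b : halfLattice a, ‖Matrix.toEuclideanCLM (𝕜 := ℝ) (V b)‖) ≤ M →
      ∀ δ : EuclideanSpace ℝ (Fin d), δ ∈ halfLattice a → δ ≠ 0 →
        (∀ x ∈ halfLattice a, (∃ t : ℝ, x = t • δ) → ∃ n : ℤ, x = (n : ℝ) • δ) →
      ∀ γ : EuclideanSpace ℝ (Fin d),
        c₁ * ρ ≤ ‖γ‖ → ‖γ‖ ≤ c₂ * ρ →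
        γ ∈ resDomain δ (ρ ^ (3 * α)) →
        (∀ w ∈ latticeBall a ((p₁ : ℝ) * ρ ^ α), (¬∃ t : ℝ, w = t • δ) →
          γ ∉ resDomain w (ρ ^ (9 * α))) →
      ∀ b₁ a₁ : ℕ, ∀ hab : a₁ ≤ b₁,
      ∀ h : Fin b₁ → EuclideanSpace ℝ (Fin d), Function.Injective h →
        Set.range h = B1Set a δ γ ρ α p₁ →
        (∀ τ : Fin b₁, ((τ : ℕ) < a₁ ↔ ∃ n : ℤ, h τ = γ + (n : ℝ) • δ)) →
      ∀ η : ℝ, (blockC V h).IsEigenvalueOf η →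
        (∃ s : Fin b₁, (s : ℕ) < a₁ ∧ |η - ‖h s‖ ^ 2| < M) →
        ∃ η' : ℝ, (blockC V (fun i : Fin a₁ => h (Fin.castLE hab i))).IsEigenvalueOf η' ∧
          |η - η'| ≤ c * ρ ^ (-(3 / 4) * (9 * α)) := by
  obtain ⟨κ, hκ, hκle⟩ := exists_pos_le_norm_halfLattice a ha
  set C : ℝ := 3 * p₁ + 2 * (p₁ : ℝ) ^ 2 + (1 + 2 * p₁) / κ with hC
  set U : ℝ := max 1 (max (4 * C) (16 * M)) with hU
  have hU1 : 1 ≤ U := le_max_left _ _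
  refine ⟨16 * M ^ 2, by positivity, U ^ (2 / α), by positivity, ?_⟩
  intro ρ hρ V _ hVneg hVs hVM δ hδ hδ0 hδmin γ _ _ hγδ hγw b₁ a₁ hab h hinj hrange hline η hη hs
  have hρ1 : 1 ≤ ρ := (Real.one_le_rpow hU1 (by positivity)).trans hρ
  have hρ0 : 0 < ρ := by linarith
  set u : ℝ := ρ ^ (α / 2) with hu
  have hUu : U ≤ u := by
    calc U = (U ^ (2 / α)) ^ (α / 2) := by
          rw [← Real.rpow_mul (by positivity)]
          field_simp
          simp
      _ ≤ u := Real.rpow_le_rpow (by positivity) hρ (by positivity)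
  have hu1 : 1 ≤ u := hU1.trans hUu
  have hpow : ∀ (k : ℕ) (e : ℝ), e = α / 2 * k → ρ ^ e = u ^ k := fun k e he => by
    rw [he, Real.rpow_mul hρ0.le, Real.rpow_natCast]
  have h2 := hpow 2 α (by push_cast; ring)
  have h6 := hpow 6 (3 * α) (by push_cast; ring)
  have h9 := hpow 9 (9 * α / 2) (by push_cast; ring)
  have h18 := hpow 18 (9 * α) (by push_cast; ring)
  have huC : 4 * C ≤ u := ((le_max_left _ _).trans (le_max_right _ _)).trans hUu
  have huM : 16 * M ≤ u := ((le_max_right _ _).trans (le_max_right _ _)).trans hUu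
  have hmem : ∀ τ, ∃ n : ℤ, ‖(n : ℝ) • δ‖ < 1 / 2 * u ^ 9 ∧
      ∃ w, (w ∈ latticeBall a (p₁ * ρ ^ α) ∨ w = 0) ∧ h τ = γ + (n : ℝ) • δ + w := fun τ => by
    have h1 : h τ ∈ B1Set a δ γ ρ α p₁ := hrange ▸ Set.mem_range_self τ
    obtain ⟨n, hn, w, hw, he⟩ := h1
    exact ⟨n, h9 ▸ hn, w, hw, he⟩
  have hball : ∀ w, (w ∈ latticeBall a (p₁ * ρ ^ α) ∨ w = 0) →
      w ∈ halfLattice a ∧ ‖w‖ < p₁ * u ^ 2 := by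
    rintro w (hw | rfl)
    · exact ⟨hw.1, h2 ▸ hw.2.2⟩
    · refine ⟨⟨0, fun i => by simp⟩, ?_⟩
      rw [norm_zero]
      positivity
  have hshift : ∀ τ, h τ - γ ∈ halfLattice a := fun τ => by
    obtain ⟨n, _, w, hw, he⟩ := hmem τ
    rw [he, add_assoc, add_sub_cancel_left]
    exact halfLattice_add_mem (halfLattice_zsmul_mem hδ n) (hball w hw).1
  have hdiff : ∀ τ ξ, h τ - h ξ ∈ halfLattice a := fun τ ξ => by
    simpa using halfLattice_sub_mem (hshift τ) (hshift ξ)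
  have hoff : ∀ τ ξ, ‖offDiagBlock V h τ ξ‖
      ≤ ‖Matrix.toEuclideanCLM (𝕜 := ℝ) (V (h τ - h ξ))‖ := fun τ ξ => by
    unfold offDiagBlock
    split_ifs <;> simp
  have hrow : ∀ τ, ∑ ξ, ‖offDiagBlock V h τ ξ‖ ≤ M := fun τ =>
    (Finset.sum_le_sum fun ξ _ => hoff τ ξ).trans <|
      (sum_norm_comp_le_tsum (f := fun b => ‖Matrix.toEuclideanCLM (𝕜 := ℝ) (V b)‖)
        (fun _ => norm_nonneg _) hVs (g := fun ξ => h τ - h ξ)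
        (fun ξ ξ' he => hinj (sub_right_injective he)) (hdiff τ)).trans hVM
  have hcol : ∀ ξ, ∑ τ, ‖offDiagBlock V h τ ξ‖ ≤ M := fun ξ =>
    (Finset.sum_le_sum fun τ _ => hoff τ ξ).trans <|
      (sum_norm_comp_le_tsum (f := fun b => ‖Matrix.toEuclideanCLM (𝕜 := ℝ) (V b)‖)
        (fun _ => norm_nonneg _) hVs (g := fun τ => h τ - h ξ)
        (fun τ τ' he => hinj (sub_left_injective he)) (fun τ => hdiff τ ξ)).trans hVM
  have hu18 : u ≤ u ^ 18 := le_self_pow₀ hu1 (by norm_num)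
  have hgap : ∀ τ : Fin b₁, ¬ (τ : ℕ) < a₁ → 1 / 8 * u ^ 18 ≤ |η - ‖h τ‖ ^ 2| := fun τ hτ => by
    obtain ⟨s, hsa, hsM⟩ := hs
    obtain ⟨n, hn, w, hw, he⟩ := hmem τ
    obtain ⟨k, hk⟩ := (hline s).1 hsa
    obtain ⟨n', hn', w', hw', he'⟩ := hmem s
    have hnot : ¬ ∃ t : ℝ, w = t • δ := fun ht => by
      obtain ⟨l, hl⟩ := hδmin w (hball w hw).1 ht
      exact hτ ((hline τ).2 ⟨n + l, by rw [he, hl]; push_cast; module⟩)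
    have hwball : w ∈ latticeBall a (p₁ * ρ ^ α) :=
      hw.resolve_right fun h0 => hnot ⟨0, by simp [h0]⟩
    have hkB : ‖(k : ℝ) • δ‖ < 1 / 2 * u ^ 9 + p₁ * u ^ 2 := by
      have hkw : (k : ℝ) • δ = (n' : ℝ) • δ + w' := by
        rw [hk, add_assoc] at he'
        exact add_left_cancel he'
      rw [hkw]
      exact (norm_add_le _ _).trans_lt (add_lt_add hn' (hball w' hw').2)
    have hres : u ^ 18 ≤ |‖γ‖ ^ 2 - ‖γ + w‖ ^ 2| := by
      rw [← h18]
      exact not_lt.1 (hγw w hwball hnot)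
    have hγδ' : |‖γ‖ ^ 2 - ‖γ + δ‖ ^ 2| < u ^ 6 := h6 ▸ hγδ
    have hE := energy_gap hκ (hκle δ hδ hδ0) (Nat.cast_nonneg p₁) hu1 hγδ' hn (hball w hw).2 hkB
      hres
    rw [← he, ← hk, ← hC] at hE
    have hCu : C * u ^ 15 ≤ 1 / 4 * u ^ 18 := by
      have hu3 : u ≤ u ^ 3 := le_self_pow₀ hu1 (by norm_num)
      have : 4 * C * u ^ 15 ≤ u ^ 3 * u ^ 15 := by
        gcongr
        exact huC.trans hu3
      nlinarith
    have htri := abs_sub_le (‖h τ‖ ^ 2) η (‖h s‖ ^ 2)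
    rw [abs_sub_comm (‖h τ‖ ^ 2) η] at htri
    linarith
  obtain ⟨r, rfl⟩ := Nat.exists_eq_add_of_le hab
  obtain ⟨η', hη', hle⟩ := exists_isEigenvalueOf_leading_blockC V h (L := 1 / 8 * u ^ 18) hM
    (by linarith) (blockC_isSymm fun τ ξ => hVneg _ (hdiff _ _)) hrow hcol
    (fun k => hgap _ (by simp)) hη
  refine ⟨η', hη', hle.trans ?_⟩
  have hexp : (u ^ 18)⁻¹ ≤ ρ ^ (-(3 / 4) * (9 * α)) := by
    rw [← h18, ← Real.rpow_neg hρ0.le]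
    exact Real.rpow_le_rpow_of_exponent_le hρ1 (by linarith)
  calc 2 * M ^ 2 / (1 / 8 * u ^ 18) = 16 * M ^ 2 * (u ^ 18)⁻¹ := by
        field_simp
        norm_num
    _ ≤ _ := by gcongr
end
end

section
/- There exist c > 0 and ρ₀ > 0 (depending only on m, |δ|, M, α₁, α₂, c₁, c₂, c₃) with the following property. Let ρ ≥ ρ₀, let l ∈ ℤ with |l| ≤ c₁ρ^{α₁}, v ∈ [0,1), and let a₁ be a positive even integer with c₂ρ^{α₂/2} ≤ a₁ ≤ c₃ρ^{α₂/2}. Suppose η ∈ ℝ and Θ = (Θ^1, Θ^2, …) ∈ ℓ²(ℕ, ℂ^m) with ∑_{j≥1} |Θ^j|² = 1 satisfy, for every j ≥ 1, the eigenvector equation (η − |(j′+v)δ|²) Θ^j = ∑_{k≥1, k≠j} W_{n_k − n_j} Θ^k, and suppose |η − |(s′+v)δ|²| < M for some s ∈ {1,…,a₁/2}. Then the m·a₁ × m·a₁ matrix E = E(γ,δ) has an eigenvalue η̃ with |η − η̃| ≤ c·ρ^{−(3/4)α₂}. -/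
open Matrix

noncomputable section

/-- `n_j` for `j ≥ 1`: `n_j = −j/2` if `j` is even and `n_j = (j−1)/2` if `j` is odd. -/
def nIdx (j : ℕ) : ℤ := if j % 2 = 0 then -((j : ℤ) / 2) else ((j : ℤ) - 1) / 2

/-- The `m·a₁ × m·a₁` block matrix `E(γ,δ)` with diagonal blocks `|(j′+v)δ|² I_m`
(`j′ = l + n_j`, `j = 1,…,a₁`, `nδ2 = |δ|²`) and off-diagonal blocks `W_{n_j − n_k}`. -/
def blockE (m : ℕ) (W : ℤ → Matrix (Fin m) (Fin m) ℝ) (l : ℤ) (v nδ2 : ℝ) (a₁ : ℕ) :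
    Matrix (Fin a₁ × Fin m) (Fin a₁ × Fin m) ℝ :=
  fun p q =>
    if p.1 = q.1 then
      (if p.2 = q.2 then (((l + nIdx ((p.1 : ℕ) + 1) : ℤ) : ℝ) + v) ^ 2 * nδ2 else 0)
    else W (nIdx ((p.1 : ℕ) + 1) - nIdx ((q.1 : ℕ) + 1)) p.2 q.2

open scoped ENNReal

/-- Weighted Cauchy–Schwarz inequality for `ℝ≥0∞`-valued series. -/
theorem ENNReal.tsum_mul_sq_le {κ : Type*} (w t : κ → ℝ≥0∞) :
    (∑' k, w k * t k) ^ 2 ≤ (∑' k, w k) * ∑' k, w k * t k ^ 2 := by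
  have h : ∑' k, w k * t k ≤
      (∑' k, w k) ^ (1 / 2 : ℝ) * (∑' k, w k * t k ^ 2) ^ (1 / 2 : ℝ) := by
    rw [ENNReal.tsum_eq_iSup_sum]
    refine iSup_le fun s => ?_
    have := ENNReal.inner_le_weight_mul_Lp_of_nonneg s (p := 2) one_le_two w t
    rw [show (1 - (2 : ℝ)⁻¹) = 1 / 2 by norm_num, show ((2 : ℝ)⁻¹) = 1 / 2 by norm_num] at this
    simp only [ENNReal.rpow_ofNat] at this
    refine this.trans ?_
    gcongr
    · exact ENNReal.sum_le_tsum s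
    · exact ENNReal.sum_le_tsum s
  calc _ ≤ ((∑' k, w k) ^ (1 / 2 : ℝ) * (∑' k, w k * t k ^ 2) ^ (1 / 2 : ℝ)) ^ 2 := by gcongr
    _ = _ := by
      rw [← ENNReal.rpow_ofNat, ENNReal.mul_rpow_of_nonneg _ _ (by norm_num),
        ← ENNReal.rpow_mul, ← ENNReal.rpow_mul]
      norm_num

/-- Schur test: a nonnegative kernel with row and column sums at most `C` has `ℓ²` norm at
most `C`. -/
theorem ENNReal.tsum_sq_tsum_mul_le {ι κ : Type*} (w : ι → κ → ℝ≥0∞) (C : ℝ≥0∞)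
    (hrow : ∀ j, ∑' k, w j k ≤ C) (hcol : ∀ k, ∑' j, w j k ≤ C) (t : κ → ℝ≥0∞) :
    ∑' j, (∑' k, w j k * t k) ^ 2 ≤ C ^ 2 * ∑' k, t k ^ 2 :=
  calc ∑' j, (∑' k, w j k * t k) ^ 2
      ≤ ∑' j, C * ∑' k, w j k * t k ^ 2 := by
        refine ENNReal.tsum_le_tsum fun j => (ENNReal.tsum_mul_sq_le _ _).trans ?_
        gcongr
        exact hrow j
    _ = C * ∑' k, (∑' j, w j k) * t k ^ 2 := by
        rw [ENNReal.tsum_mul_left, ENNReal.tsum_comm]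
        simp only [ENNReal.tsum_mul_right]
    _ ≤ C * ∑' k, C * t k ^ 2 := by
        gcongr with k
        exact hcol k
    _ = C ^ 2 * ∑' k, t k ^ 2 := by rw [ENNReal.tsum_mul_left]; ring

/-- If `t` is normalized in `ℓ²` and solves `(η - d j) t j = ∑ k, f j k` with
`‖f j k‖ ≤ w j k ‖t k‖`, then the restriction of `t` to a finite index set outside of which
`|η - d j| ≥ K` is nonzero and solves the truncated system up to an error of size `O(C² / K)`. -/
theorem sum_sq_norm_truncation_residual_le {J ι F : Type*} [Fintype ι] [NormedAddCommGroup F]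
    [NormedSpace ℝ F] [CompleteSpace F] (e : ι ↪ J) (η : ℝ) (d : J → ℝ) (t : J → F)
    (f : J → J → F) (w : J → J → ℝ≥0∞) {C K : ℝ} (hC : 0 < C) (hK : 2 * C ≤ K)
    (hrow : ∀ j, ∑' k, w j k ≤ ENNReal.ofReal C) (hcol : ∀ k, ∑' j, w j k ≤ ENNReal.ofReal C)
    (hf : ∀ j k, ‖f j k‖ₑ ≤ w j k * ‖t k‖ₑ) (ht : ∑' j, ‖t j‖ ^ 2 = 1)
    (heq : ∀ j, (η - d j) • t j = ∑' k, f j k) (hd : ∀ j ∉ Set.range e, K ≤ |η - d j|) :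
    0 < ∑ i, ‖t (e i)‖ ^ 2 ∧ ∑ i, ‖(η - d (e i)) • t (e i) - ∑ k, f (e i) (e k)‖ ^ 2 ≤
      (2 * C ^ 2 / K) ^ 2 * ∑ i, ‖t (e i)‖ ^ 2 := by
  classical
  have hK0 : 0 < K := by linarith
  have hsum : Summable fun j => ‖t j‖ ^ 2 := by
    by_contra h
    rw [tsum_eq_zero_of_not_summable h] at ht
    exact zero_ne_one ht
  have hle : ∀ j, ‖t j‖ ≤ 1 := fun j => by
    have := hsum.le_tsum j fun _ _ => by positivity
    rw [ht] at this
    exact (sq_le_one_iff₀ (norm_nonneg _)).1 this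
  have henorm : ∀ x : F, ‖x‖ₑ ^ 2 = ENNReal.ofReal (‖x‖ ^ 2) := fun x => by
    rw [ENNReal.ofReal_pow (norm_nonneg _), ofReal_norm]
  have ht' : ∑' j, ‖t j‖ₑ ^ 2 = 1 := by
    simp only [henorm]
    rw [← ENNReal.ofReal_tsum_of_nonneg (fun _ => by positivity) hsum, ht, ENNReal.ofReal_one]
  set S : Finset J := Finset.univ.map e with hS
  have hmem : ∀ j : ((S : Set J)ᶜ : Set J), (j : J) ∉ Set.range e := fun j => by
    have := j.2
    simpa [hS] using this
  -- the tail of the eigenvector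
  set T : ℝ := ∑' j : ((S : Set J)ᶜ : Set J), ‖t j‖ ^ 2 with hT
  have hTsum : Summable fun j : ((S : Set J)ᶜ : Set J) => ‖t j‖ ^ 2 := hsum.subtype _
  have hT0 : 0 ≤ T := tsum_nonneg fun _ => by positivity
  have hTe : ∑' j : ((S : Set J)ᶜ : Set J), ‖t j‖ₑ ^ 2 = ENNReal.ofReal T := by
    simp only [henorm]
    rw [← ENNReal.ofReal_tsum_of_nonneg (fun _ => by positivity) hTsum]
  have htail : K ^ 2 * T ≤ C ^ 2 := by
    rw [← ENNReal.ofReal_le_ofReal_iff (by positivity), ENNReal.ofReal_mul (by positivity),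
      ← hTe, ← ENNReal.tsum_mul_left, ENNReal.ofReal_pow hC.le]
    calc _ ≤ ∑' j : ((S : Set J)ᶜ : Set J), (∑' k, w j k * ‖t k‖ₑ) ^ 2 := by
          refine ENNReal.tsum_le_tsum fun j => ?_
          rw [ENNReal.ofReal_pow hK0.le, ← mul_pow]
          gcongr
          calc ENNReal.ofReal K * ‖t j‖ₑ ≤ ‖(η - d j) • t j‖ₑ := by
                rw [enorm_smul, Real.enorm_eq_ofReal_abs]
                gcongr
                exact hd j (hmem j)
            _ ≤ _ := by
                rw [heq]
                exact enorm_tsum_le_tsum_enorm.trans (ENNReal.tsum_le_tsum fun k => hf j k)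
      _ ≤ ENNReal.ofReal C ^ 2 * ∑' k, ‖t k‖ₑ ^ 2 :=
          ENNReal.tsum_sq_tsum_mul_le (fun (j : ((S : Set J)ᶜ : Set J)) k => w j k) _
            (fun j => hrow j)
            (fun k => (ENNReal.tsum_comp_le_tsum_of_injective Subtype.val_injective _).trans
              (hcol k)) _
      _ = _ := by rw [ht', mul_one]
  have hhead : ∑ i, ‖t (e i)‖ ^ 2 + T = 1 := by
    rw [← ht, ← hsum.sum_add_tsum_compl (s := S), hS, Finset.sum_map]
  have hres : ∀ i, (η - d (e i)) • t (e i) - ∑ k, f (e i) (e k) =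
      ∑' k : ((S : Set J)ᶜ : Set J), f (e i) k := fun i => by
    have hfs : Summable fun k => f (e i) k := by
      refine Summable.of_enorm (ne_top_of_le_ne_top (ENNReal.ofReal_ne_top (r := C)) ?_)
      refine (ENNReal.tsum_le_tsum fun k => ?_).trans (hrow (e i))
      refine (hf _ k).trans (mul_le_of_le_one_right' ?_)
      rw [← ofReal_norm]
      exact ENNReal.ofReal_le_one.2 (hle k)
    rw [heq, ← hfs.sum_add_tsum_compl (s := S), hS, Finset.sum_map, add_sub_cancel_left]
  have hR : ∑ i, ‖(η - d (e i)) • t (e i) - ∑ k, f (e i) (e k)‖ ^ 2 ≤ C ^ 2 * T := by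
    rw [← ENNReal.ofReal_le_ofReal_iff (by positivity), ENNReal.ofReal_mul (by positivity),
      ← hTe, ENNReal.ofReal_pow hC.le, ENNReal.ofReal_sum_of_nonneg (fun _ _ => by positivity)]
    simp only [← henorm, hres]
    rw [← tsum_fintype (L := .unconditional _)]
    calc _ ≤ ∑' i, (∑' k : ((S : Set J)ᶜ : Set J), w (e i) k * ‖t k‖ₑ) ^ 2 := by
          refine ENNReal.tsum_le_tsum fun i => ?_
          gcongr
          exact enorm_tsum_le_tsum_enorm.trans (ENNReal.tsum_le_tsum fun k => hf _ k)
      _ ≤ _ := ENNReal.tsum_sq_tsum_mul_le (fun i (k : ((S : Set J)ᶜ : Set J)) => w (e i) k) _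
            (fun i => (ENNReal.tsum_comp_le_tsum_of_injective Subtype.val_injective _).trans
              (hrow (e i)))
            (fun k => (ENNReal.tsum_comp_le_tsum_of_injective e.injective
              (fun j => w j k)).trans (hcol k)) _
  have hT4 : T ≤ 1 / 4 := by
    have h4 : 4 * C ^ 2 ≤ K ^ 2 := by nlinarith
    have : 0 < C ^ 2 := by positivity
    nlinarith [mul_le_mul_of_nonneg_right h4 hT0]
  have hTK : T ≤ C ^ 2 / K ^ 2 := by
    rw [le_div_iff₀ (by positivity)]; linarith
  refine ⟨by linarith, ?_⟩
  calc _ ≤ C ^ 2 * T := hR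
    _ ≤ C ^ 2 * (C ^ 2 / K ^ 2) := by gcongr
    _ = (2 * C ^ 2 / K) ^ 2 * (1 / 4) := by field_simp; ring
    _ ≤ _ := by gcongr; linarith

/-- A real symmetric matrix has an eigenvalue within `ε` of any `η` with an `ε`-approximate
eigenvector. -/
theorem Matrix.IsSymm.exists_eigenvalue_near {n : Type*} [Fintype n] [DecidableEq n]
    {A : Matrix n n ℝ} (hA : A.IsSymm) {η ε : ℝ} (hε : 0 ≤ ε) {x : n → ℝ} (hx : x ≠ 0)
    (h : ∑ p, (A.mulVec x p - η * x p) ^ 2 ≤ ε ^ 2 * ∑ p, x p ^ 2) :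
    ∃ η' : ℝ, (∃ y : n → ℝ, y ≠ 0 ∧ A.mulVec y = η' • y) ∧ |η - η'| ≤ ε := by
  have hH : A.IsHermitian := by
    rw [Matrix.IsHermitian, Matrix.conjTranspose_eq_transpose_of_trivial]; exact hA
  set b := hH.eigenvectorBasis
  by_contra! hcon
  have hfar : ∀ i, ε < |η - hH.eigenvalues i| := fun i =>
    hcon _ ⟨b i, fun h0 => b.orthonormal.ne_zero i (by ext p; exact congrFun h0 p),
      hH.mulVec_eigenvectorBasis i⟩
  let X : EuclideanSpace ℝ n := WithLp.toLp 2 x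
  let Y : EuclideanSpace ℝ n := WithLp.toLp 2 (A.mulVec x - η • x)
  have hXY : ∀ i, inner ℝ (b i) Y = (hH.eigenvalues i - η) * inner ℝ (b i) X := fun i => by
    have h1 : inner ℝ (b i) Y = (A.mulVec x - η • x) ⬝ᵥ (b i).ofLp := by
      simp [Y, EuclideanSpace.inner_eq_star_dotProduct]
    have h2 : inner ℝ (b i) X = x ⬝ᵥ (b i).ofLp := by
      simp [X, EuclideanSpace.inner_eq_star_dotProduct]
    rw [h1, h2, sub_dotProduct, smul_dotProduct, dotProduct_comm (A.mulVec x),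
      Matrix.dotProduct_mulVec, ← Matrix.mulVec_transpose, hA.eq,
      hH.mulVec_eigenvectorBasis, smul_dotProduct, dotProduct_comm x]
    simp only [smul_eq_mul]
    ring
  have hX : ∑ i, ‖inner ℝ (b i) X‖ ^ 2 = ∑ p, x p ^ 2 := by
    rw [b.sum_sq_norm_inner_right, EuclideanSpace.norm_sq_eq]; simp [X]
  have hY : ∑ i, ‖inner ℝ (b i) Y‖ ^ 2 = ∑ p, (A.mulVec x p - η * x p) ^ 2 := by
    rw [b.sum_sq_norm_inner_right, EuclideanSpace.norm_sq_eq]; simp [Y]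
  rw [← hX, ← hY, Finset.mul_sum] at h
  have hterm : ∀ i, ‖inner ℝ (b i) Y‖ ^ 2 =
      |η - hH.eigenvalues i| ^ 2 * ‖inner ℝ (b i) X‖ ^ 2 := fun i => by
    rw [hXY, norm_mul, mul_pow, Real.norm_eq_abs, abs_sub_comm]
  have hX0 : 0 < ∑ i, ‖inner ℝ (b i) X‖ ^ 2 := by
    rw [hX]
    obtain ⟨p, hp⟩ := Function.ne_iff.1 hx
    exact Finset.sum_pos' (fun _ _ => sq_nonneg _)
      ⟨p, Finset.mem_univ _, by have : x p ≠ 0 := hp; positivity⟩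
  obtain ⟨i, hi, hi0⟩ := Finset.exists_lt_of_sum_lt (s := Finset.univ) (f := fun _ : n => (0 : ℝ))
    (g := fun i => ‖inner ℝ (b i) X‖ ^ 2) (by simpa using hX0)
  refine absurd h (not_le.2 (Finset.sum_lt_sum (fun j _ => ?_) ⟨i, hi, ?_⟩))
  · rw [hterm]
    gcongr
    exact (hfar j).le
  · rw [hterm]
    exact mul_lt_mul_of_pos_right (pow_lt_pow_left₀ (hfar i) hε two_ne_zero) hi0

/-- Version of `Matrix.IsSymm.exists_eigenvalue_near` for complex approximate eigenvectors. -/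
theorem Matrix.IsSymm.exists_eigenvalue_near_of_complex {n : Type*} [Fintype n] [DecidableEq n]
    {A : Matrix n n ℝ} (hA : A.IsSymm) {η ε : ℝ} (hε : 0 ≤ ε) {z : n → ℂ} (hz : z ≠ 0)
    (h : ∑ p, ‖∑ q, (A p q : ℂ) * z q - η * z p‖ ^ 2 ≤ ε ^ 2 * ∑ p, ‖z p‖ ^ 2) :
    ∃ η' : ℝ, (∃ y : n → ℝ, y ≠ 0 ∧ A.mulVec y = η' • y) ∧ |η - η'| ≤ ε := by
  have hsq : ∀ u : ℂ, ‖u‖ ^ 2 = u.re ^ 2 + u.im ^ 2 := fun u => by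
    rw [Complex.sq_norm, Complex.normSq_apply]; ring
  simp only [hsq, Finset.sum_add_distrib, mul_add] at h
  simp only [Complex.sub_re, Complex.sub_im, Complex.re_sum, Complex.im_sum, Complex.re_ofReal_mul,
    Complex.im_ofReal_mul] at h
  by_cases hre : (∑ p, (A.mulVec (fun q => (z q).re) p - η * (z p).re) ^ 2 ≤
      ε ^ 2 * ∑ p, (z p).re ^ 2) ∧ (fun q => (z q).re) ≠ 0
  · exact hA.exists_eigenvalue_near hε hre.2 hre.1
  have him : ∑ p, (A.mulVec (fun q => (z q).im) p - η * (z p).im) ^ 2 ≤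
      ε ^ 2 * ∑ p, (z p).im ^ 2 := by
    by_cases h0 : (fun q => (z q).re) = 0
    · have h0' : ∀ q, (z q).re = 0 := congrFun h0
      simpa [h0', Matrix.mulVec, dotProduct] using h
    · have h1 := not_le.1 fun h2 => hre ⟨h2, h0⟩
      simp only [Matrix.mulVec, dotProduct] at h1 ⊢
      linarith
  refine hA.exists_eigenvalue_near hε (fun h0 => ?_) him
  refine hre ⟨?_, fun h1 => hz ?_⟩
  · have h0' : ∀ q, (z q).im = 0 := congrFun h0
    simpa [h0', Matrix.mulVec, dotProduct] using h
  · funext q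
    exact Complex.ext (congrFun h1 q) (congrFun h0 q)

/-- The complexification of a real matrix has the same operator norm bound. -/
theorem Matrix.norm_toEuclideanCLM_map_ofReal_apply_le {n : Type*} [Fintype n] [DecidableEq n]
    (A : Matrix n n ℝ) (z : EuclideanSpace ℂ n) :
    ‖Matrix.toEuclideanCLM (𝕜 := ℂ) (A.map Complex.ofReal) z‖ ≤
      ‖Matrix.toEuclideanCLM (𝕜 := ℝ) A‖ * ‖z‖ := by
  have hsq : ∀ u : EuclideanSpace ℂ n, ‖u‖ ^ 2 =
      ‖(WithLp.toLp 2 fun p => (u p).re : EuclideanSpace ℝ n)‖ ^ 2 +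
      ‖(WithLp.toLp 2 fun p => (u p).im : EuclideanSpace ℝ n)‖ ^ 2 := fun u => by
    simp only [EuclideanSpace.norm_sq_eq, ← Finset.sum_add_distrib]
    refine Finset.sum_congr rfl fun p _ => ?_
    rw [Complex.sq_norm, Complex.normSq_apply]
    simp only [Real.norm_eq_abs, sq_abs]
    ring
  have hre : (WithLp.toLp 2 fun p =>
      (Matrix.toEuclideanCLM (𝕜 := ℂ) (A.map Complex.ofReal) z p).re : EuclideanSpace ℝ n) =
      Matrix.toEuclideanCLM (𝕜 := ℝ) A (WithLp.toLp 2 fun p => (z p).re) := by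
    rw [Matrix.toEuclideanCLM_toLp]
    ext p
    simp [Matrix.mulVec, dotProduct]
  have him : (WithLp.toLp 2 fun p =>
      (Matrix.toEuclideanCLM (𝕜 := ℂ) (A.map Complex.ofReal) z p).im : EuclideanSpace ℝ n) =
      Matrix.toEuclideanCLM (𝕜 := ℝ) A (WithLp.toLp 2 fun p => (z p).im) := by
    rw [Matrix.toEuclideanCLM_toLp]
    ext p
    simp [Matrix.mulVec, dotProduct]
  refine le_of_sq_le_sq ?_ (by positivity)
  rw [hsq, hre, him, mul_pow, hsq z, mul_add, ← mul_pow, ← mul_pow]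
  gcongr <;> exact ContinuousLinearMap.le_opNorm _ _

theorem two_mul_nIdx (j : ℕ) : 2 * nIdx j = -j ∨ 2 * nIdx j = j - 1 := by
  unfold nIdx
  split_ifs <;> omega

theorem nIdx_injOn : Set.InjOn nIdx {j | 0 < j} := by
  intro j (hj : 0 < j) k (hk : 0 < k) h
  have := two_mul_nIdx j
  have := two_mul_nIdx k
  omega

theorem abs_nIdx_le {j : ℕ} (hj : 0 < j) : |(nIdx j : ℝ)| ≤ j / 2 := by
  have h1 : (1 : ℝ) ≤ j := by exact_mod_cast hj
  rw [abs_le]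
  rcases two_mul_nIdx j with h | h <;> replace h := congrArg (Int.cast : ℤ → ℝ) h <;>
    push_cast at h <;> constructor <;> linarith

theorem le_abs_nIdx (j : ℕ) : ((j : ℝ) - 1) / 2 ≤ |(nIdx j : ℝ)| := by
  rw [le_abs]
  rcases two_mul_nIdx j with h | h <;> replace h := congrArg (Int.cast : ℤ → ℝ) h <;>
    push_cast at h
  · right; linarith
  · left; linarith

/-- A spectral parameter which is `M`-close to one of the first `a / 2` diagonal entries is
far away from the diagonal entries with index greater than `a`. -/
theorem gap_of_close {l : ℤ} {v D M η a : ℝ} {s j : ℕ} (hD : 0 ≤ D) (ha : 0 ≤ a)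
    (hl : |(l : ℝ)| ≤ a / 64) (hv : |v| ≤ a / 64) (hs : 0 < s) (hsa : (s : ℝ) ≤ a / 2)
    (hja : a + 1 ≤ j) (hMa : M ≤ D * a ^ 2 / 16)
    (hη : |η - (((l + nIdx s : ℤ) : ℝ) + v) ^ 2 * D| < M) :
    D * a ^ 2 / 16 ≤ |η - (((l + nIdx j : ℤ) : ℝ) + v) ^ 2 * D| := by
  have h1 := abs_nIdx_le hs
  have h2 := le_abs_nIdx j
  push_cast at hη ⊢
  have hb : |(l : ℝ) + nIdx s + v| ≤ 9 * a / 32 := by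
    have := abs_add_three (l : ℝ) (nIdx s) v
    linarith
  have hc : 15 * a / 32 ≤ |(l : ℝ) + nIdx j + v| := by
    have h3 : |(nIdx j : ℝ)| ≤ |(l : ℝ) + nIdx j + v| + |(l : ℝ)| + |v| := by
      have := abs_add_three ((l : ℝ) + nIdx j + v) (-l) (-v)
      rw [abs_neg, abs_neg] at this
      rwa [show (l : ℝ) + nIdx j + v + -l + -v = nIdx j by ring] at this
    linarith
  have hb2 : ((l : ℝ) + nIdx s + v) ^ 2 ≤ (9 * a / 32) ^ 2 := by
    rw [← sq_abs]; gcongr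
  have hc2 : (15 * a / 32) ^ 2 ≤ ((l : ℝ) + nIdx j + v) ^ 2 := by
    rw [← sq_abs ((l : ℝ) + nIdx j + v)]; gcongr
  have hb3 := mul_le_mul_of_nonneg_right hb2 hD
  have hc3 := mul_le_mul_of_nonneg_right hc2 hD
  have := (abs_lt.1 hη).2
  rw [abs_sub_comm]
  refine le_trans ?_ (le_abs_self _)
  have : 0 ≤ D * a ^ 2 := by positivity
  nlinarith

theorem blockE_isSymm {m : ℕ} {W : ℤ → Matrix (Fin m) (Fin m) ℝ} (hW : ∀ n, W (-n) = (W n)ᵀ)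
    (l : ℤ) (v D : ℝ) (a : ℕ) : (blockE m W l v D a).IsSymm := by
  ext p q
  simp only [Matrix.transpose_apply, blockE]
  by_cases h : p.1 = q.1
  · simp only [h, if_true, eq_comm]
  · rw [if_neg h, if_neg (Ne.symm h), ← neg_sub, hW, Matrix.transpose_apply]

theorem sum_blockE_mul {m : ℕ} {W : ℤ → Matrix (Fin m) (Fin m) ℝ} (hsymm : ∀ n, (W n).IsSymm)
    (hW : ∀ n, W (-n) = (W n)ᵀ) (l : ℤ) (v D : ℝ) (a : ℕ)
    (t : Fin a → EuclideanSpace ℂ (Fin m)) (p : Fin a × Fin m) :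
    ∑ q, (blockE m W l v D a p q : ℂ) * t q.1 q.2 =
      ((((l + nIdx ((p.1 : ℕ) + 1) : ℤ) : ℝ) + v) ^ 2 * D : ℝ) * t p.1 p.2 +
      (∑ k, if k = p.1 then 0 else Matrix.toEuclideanCLM (𝕜 := ℂ)
        ((W (nIdx ((k : ℕ) + 1) - nIdx ((p.1 : ℕ) + 1))).map Complex.ofReal) (t k)) p.2 := by
  obtain ⟨i, b⟩ := p
  rw [Fintype.sum_prod_type, WithLp.ofLp_sum, Finset.sum_apply,
    ← Finset.add_sum_erase _ _ (Finset.mem_univ i),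
    ← Finset.add_sum_erase _ (fun k => (WithLp.ofLp (ite (k = i) _ _) : Fin m → ℂ) b)
      (Finset.mem_univ i)]
  simp only [if_true]
  congr 1
  · rw [Finset.sum_eq_single b (fun c _ hc => by simp [blockE, hc.symm]) (by simp)]
    simp [blockE]
  · rw [WithLp.ofLp_zero, Pi.zero_apply, zero_add]
    refine Finset.sum_congr rfl fun k hk => ?_
    have hki := Finset.ne_of_mem_erase hk
    rw [if_neg hki, Matrix.ofLp_toEuclideanCLM, Matrix.mulVec, dotProduct]
    refine Finset.sum_congr rfl fun c _ => ?_
    simp only [blockE, if_neg hki.symm, Matrix.map_apply]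
    rw [← neg_sub, hW, (hsymm _).eq]

/-- The truncation error bound, for a threshold `K` separating `η` from the diagonal entries
left out of the truncation. -/
theorem exists_eigenvalue_blockE_near {m : ℕ} {W : ℤ → Matrix (Fin m) (Fin m) ℝ}
    (hsymm : ∀ n, (W n).IsSymm) (hW : ∀ n, W (-n) = (W n)ᵀ)
    (hsum : Summable fun n : ℤ => ‖Matrix.toEuclideanCLM (𝕜 := ℝ) (W n)‖) {M K : ℝ}
    (hM : 0 < M) (hWM : ∑' n : ℤ, ‖Matrix.toEuclideanCLM (𝕜 := ℝ) (W n)‖ ≤ M)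
    (hK : 2 * M ≤ K) (l : ℤ) (v D : ℝ) (a : ℕ) (η : ℝ)
    (Θ : {j : ℕ // 0 < j} → EuclideanSpace ℂ (Fin m)) (hΘ : ∑' j, ‖Θ j‖ ^ 2 = 1)
    (heq : ∀ j : {j : ℕ // 0 < j},
      (η - (((l + nIdx (j : ℕ) : ℤ) : ℝ) + v) ^ 2 * D) • Θ j =
        ∑' k : {j : ℕ // 0 < j}, if k = j then 0 else
          Matrix.toEuclideanCLM (𝕜 := ℂ)
            ((W (nIdx (k : ℕ) - nIdx (j : ℕ))).map Complex.ofReal) (Θ k))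
    (hgap : ∀ j : ℕ, a < j → K ≤ |η - (((l + nIdx j : ℤ) : ℝ) + v) ^ 2 * D|) :
    ∃ η' : ℝ, (blockE m W l v D a).IsEigenvalueOf η' ∧ |η - η'| ≤ 2 * M ^ 2 / K := by
  let e : Fin a ↪ {j : ℕ // 0 < j} :=
    ⟨fun i => ⟨i + 1, i.1.succ_pos⟩, fun i k h => by
      have := congrArg Subtype.val h
      exact Fin.ext (by simpa using this)⟩
  have he : ∀ i, (e i : ℕ) = i + 1 := fun _ => rfl
  have hK0 : 0 < K := by linarith
  have htot : ∑' n : ℤ, ‖Matrix.toEuclideanCLM (𝕜 := ℝ) (W n)‖ₑ ≤ ENNReal.ofReal M := by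
    simp only [← ofReal_norm]
    rw [← ENNReal.ofReal_tsum_of_nonneg (fun _ => norm_nonneg _) hsum]
    exact ENNReal.ofReal_le_ofReal hWM
  have hinj : Function.Injective fun j : {j : ℕ // 0 < j} => nIdx j := fun j k h =>
    Subtype.ext (nIdx_injOn j.2 k.2 h)
  have hd : ∀ j ∉ Set.range e, K ≤ |η - (((l + nIdx (j : ℕ) : ℤ) : ℝ) + v) ^ 2 * D| := by
    intro j hj
    refine hgap j (not_le.1 fun hja => hj ?_)
    exact ⟨⟨j - 1, by have := j.2; omega⟩, Subtype.ext (Nat.sub_add_cancel j.2)⟩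
  obtain ⟨hpos, key⟩ := sum_sq_norm_truncation_residual_le e η
    (fun j => (((l + nIdx (j : ℕ) : ℤ) : ℝ) + v) ^ 2 * D) Θ
    (fun j k => if k = j then 0 else
      Matrix.toEuclideanCLM (𝕜 := ℂ)
        ((W (nIdx (k : ℕ) - nIdx (j : ℕ))).map Complex.ofReal) (Θ k))
    (fun j k => ‖Matrix.toEuclideanCLM (𝕜 := ℝ) (W (nIdx (k : ℕ) - nIdx (j : ℕ)))‖ₑ) hM hK
    (fun j => (ENNReal.tsum_comp_le_tsum_of_injective
      (f := fun k : {j : ℕ // 0 < j} => nIdx (k : ℕ) - nIdx (j : ℕ))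
      (fun k k' h => hinj (sub_left_injective h))
      (fun n => ‖Matrix.toEuclideanCLM (𝕜 := ℝ) (W n)‖ₑ)).trans htot)
    (fun k => (ENNReal.tsum_comp_le_tsum_of_injective
      (f := fun j : {j : ℕ // 0 < j} => nIdx (k : ℕ) - nIdx (j : ℕ))
      (fun j j' h => hinj (sub_right_injective h))
      (fun n => ‖Matrix.toEuclideanCLM (𝕜 := ℝ) (W n)‖ₑ)).trans htot)
    (fun j k => by
      split_ifs
      · simp
      · simp only [← ofReal_norm]
        rw [← ENNReal.ofReal_mul (norm_nonneg _)]
        exact ENNReal.ofReal_le_ofReal (Matrix.norm_toEuclideanCLM_map_ofReal_apply_le _ _))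
    hΘ heq hd
  have hne : (fun p : Fin a × Fin m => Θ (e p.1) p.2) ≠ 0 := by
    intro h0
    have hz : ∀ i, Θ (e i) = 0 := fun i => by
      ext b
      exact congrFun h0 (i, b)
    simp [hz] at hpos
  refine (blockE_isSymm hW l v D a).exists_eigenvalue_near_of_complex (by positivity) hne ?_
  simp only [EuclideanSpace.norm_sq_eq] at key
  rw [Fintype.sum_prod_type, Fintype.sum_prod_type]
  refine le_trans (le_of_eq ?_) key
  refine Finset.sum_congr rfl fun i _ => Finset.sum_congr rfl fun b _ => ?_
  rw [sum_blockE_mul hsymm hW l v D a (fun i => Θ (e i)) (i, b), ← norm_neg]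
  simp only [e.injective.eq_iff, WithLp.ofLp_sub, WithLp.ofLp_smul, Pi.sub_apply, Pi.smul_apply,
    Complex.real_smul]
  congr 2
  simp only [he]
  push_cast
  ring

/-- Theorem 2.4 of the paper: an eigenvalue `η`, with `ℓ²`-normalized eigenvector
`Θ`, of the infinite Sturm–Liouville matrix which is `M`-close to one of the first `a₁/2`
diagonal entries, is `O(ρ^{−(3/4)α₂})`-close to an eigenvalue of the truncation `E(γ,δ)`. -/
theorem stmt6 (d : ℕ) (hd : 2 ≤ d) (m : ℕ) (hm : 2 ≤ m)
    (δ : EuclideanSpace ℝ (Fin d)) (hδ : δ ≠ 0)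
    (α₁ α₂ : ℝ) (hα₁ : 0 < α₁) (hα₁₂ : 2 * α₁ < α₂)
    (M : ℝ) (hM : 0 < M)
    (c₁ c₂ c₃ : ℝ) (hc₁ : 0 < c₁) (hc₂ : 0 < c₂) (hc₃ : 0 < c₃) :
    ∃ c > (0 : ℝ), ∃ ρ₀ > (0 : ℝ), ∀ ρ : ℝ, ρ₀ ≤ ρ →
      -- the family of directional Fourier coefficient matrices
      ∀ W : ℤ → Matrix (Fin m) (Fin m) ℝ,
        (∀ n, (W n).IsSymm) → (∀ n, W (-n) = (W n)ᵀ) →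
        Summable (fun n : ℤ => ‖Matrix.toEuclideanCLM (𝕜 := ℝ) (W n)‖) →
        (∑' n : ℤ, ‖Matrix.toEuclideanCLM (𝕜 := ℝ) (W n)‖) ≤ M →
      ∀ l : ℤ, (|l| : ℝ) ≤ c₁ * ρ ^ α₁ →
      ∀ v : ℝ, 0 ≤ v → v < 1 →
      ∀ a₁ : ℕ, 0 < a₁ → Even a₁ →
        c₂ * ρ ^ (α₂ / 2) ≤ (a₁ : ℝ) → (a₁ : ℝ) ≤ c₃ * ρ ^ (α₂ / 2) →
      ∀ η : ℝ, ∀ Θ : {j : ℕ // 0 < j} → EuclideanSpace ℂ (Fin m),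
        -- Θ ∈ ℓ²(ℕ, ℂ^m) is normalized
        (∑' j : {j : ℕ // 0 < j}, ‖Θ j‖ ^ 2) = 1 →
        -- the componentwise eigenvector equation
        (∀ j : {j : ℕ // 0 < j},
          (η - (((l + nIdx (j : ℕ) : ℤ) : ℝ) + v) ^ 2 * ‖δ‖ ^ 2) • Θ j =
            ∑' k : {j : ℕ // 0 < j},
              if k = j then 0 else
                Matrix.toEuclideanCLM (𝕜 := ℂ)
                  ((W (nIdx (k : ℕ) - nIdx (j : ℕ))).map Complex.ofReal) (Θ k)) →
        -- η is M-close to one of the first a₁/2 diagonal entries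
        (∃ s : ℕ, 1 ≤ s ∧ s ≤ a₁ / 2 ∧
          |η - (((l + nIdx s : ℤ) : ℝ) + v) ^ 2 * ‖δ‖ ^ 2| < M) →
        ∃ η' : ℝ, (blockE m W l v (‖δ‖ ^ 2) a₁).IsEigenvalueOf η' ∧
          |η - η'| ≤ c * ρ ^ (-(3 / 4) * α₂) := by
  set D : ℝ := ‖δ‖ ^ 2 with hDdef
  have hD : 0 < D := by have := norm_pos_iff.2 hδ; positivity
  have hα₂ : 0 < α₂ := by linarith
  have hB : 0 < D * c₂ ^ 2 := by positivity
  have hev : ∀ᶠ ρ : ℝ in Filter.atTop, 1 ≤ ρ ∧ 64 * c₁ / c₂ ≤ ρ ^ (α₂ / 2 - α₁) ∧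
      64 / c₂ ≤ ρ ^ (α₂ / 2) ∧ 32 * M / (D * c₂ ^ 2) ≤ ρ ^ α₂ :=
    (Filter.eventually_ge_atTop 1).and
      (((tendsto_rpow_atTop (by linarith)).eventually_ge_atTop _).and
      (((tendsto_rpow_atTop (by linarith)).eventually_ge_atTop _).and
      ((tendsto_rpow_atTop hα₂).eventually_ge_atTop _)))
  obtain ⟨ρ₁, hρ₁⟩ := Filter.eventually_atTop.1 hev
  refine ⟨32 * M ^ 2 / (D * c₂ ^ 2), by positivity, max ρ₁ 1, by positivity, ?_⟩
  intro ρ hρ W hsymm hW hsum hWM l hl v hv0 hv1 a₁ ha0 _ ha _ η Θ hΘ heq ⟨s, hs1, hsa, hη⟩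
  obtain ⟨h1, h2, h3, h4⟩ := hρ₁ ρ ((le_max_left _ _).trans hρ)
  have hρ0 : 0 < ρ := by linarith
  rw [div_le_iff₀ hc₂] at h2 h3
  rw [div_le_iff₀ hB] at h4
  have hla : |(l : ℝ)| ≤ a₁ / 64 := by
    have h5 := mul_le_mul_of_nonneg_right h2 (Real.rpow_nonneg hρ0.le α₁)
    have h6 : ρ ^ (α₂ / 2 - α₁) * ρ ^ α₁ = ρ ^ (α₂ / 2) := by
      rw [← Real.rpow_add hρ0, sub_add_cancel]
    have h7 : ρ ^ (α₂ / 2 - α₁) * c₂ * ρ ^ α₁ = c₂ * ρ ^ (α₂ / 2) := by rw [← h6]; ring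
    linarith
  have hva : |v| ≤ a₁ / 64 := by
    rw [abs_of_nonneg hv0]; linarith
  have hsq : (c₂ * ρ ^ (α₂ / 2)) ^ 2 = c₂ ^ 2 * ρ ^ α₂ := by
    rw [mul_pow, ← Real.rpow_natCast (ρ ^ (α₂ / 2)), ← Real.rpow_mul hρ0.le]
    norm_num
  have hKa : D * c₂ ^ 2 * ρ ^ α₂ / 16 ≤ D * (a₁ : ℝ) ^ 2 / 16 := by
    rw [mul_assoc, ← hsq]
    gcongr
  have hsa' : (s : ℝ) ≤ a₁ / 2 := by
    rw [le_div_iff₀ two_pos]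
    exact_mod_cast (Nat.le_div_iff_mul_le two_pos).1 hsa
  obtain ⟨η', hη', hdist⟩ := exists_eigenvalue_blockE_near hsymm hW hsum hM hWM
    (K := D * c₂ ^ 2 * ρ ^ α₂ / 16) (by linarith) l v D a₁ η Θ hΘ heq fun j hj =>
      hKa.trans (gap_of_close hD.le (by positivity) hla hva hs1 hsa' (by exact_mod_cast hj)
        (by linarith) hη)
  refine ⟨η', hη', hdist.trans ?_⟩
  calc 2 * M ^ 2 / (D * c₂ ^ 2 * ρ ^ α₂ / 16) = 32 * M ^ 2 / (D * c₂ ^ 2) * ρ ^ (-α₂) := by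
        have := Real.rpow_pos_of_pos hρ0 α₂
        rw [Real.rpow_neg hρ0.le]
        field_simp
        norm_num
    _ ≤ _ := by
        gcongr
        linarith
end
end

section
/- Let N ≥ 1 and let C = A + B be a real symmetric N×N matrix, where A is diagonal with diagonal entries a_1,…,a_N and B satisfies ‖B‖ ≤ M (operator norm). Let θ ∈ ℝ^N be a unit eigenvector of C with eigenvalue η, let S ⊆ {1,…,N}, and let R > 0 be such that |η − a_τ| ≥ R for every τ ∈ S. Then ∑_{τ∈S} θ_τ² ≤ M²/R². -/
/-- eigenvector tail estimate. If `C = A + B` is real symmetric, `A = diagonal a`,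
`‖B‖ ≤ M` (operator norm), `θ` is a unit eigenvector of `C` with eigenvalue `η`, and
`|η − a τ| ≥ R > 0` for every `τ ∈ S`, then `∑_{τ∈S} θ_τ² ≤ M²/R²`. -/
theorem stmt8 (N : ℕ) (hN : 1 ≤ N) (a : Fin N → ℝ) (B : Matrix (Fin N) (Fin N) ℝ) (M : ℝ)
    (hsym : (Matrix.diagonal a + B).IsSymm)
    (hB : ‖Matrix.toEuclideanCLM (𝕜 := ℝ) B‖ ≤ M)
    (η : ℝ) (θ : EuclideanSpace ℝ (Fin N)) (hθ : ‖θ‖ = 1)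
    (heig : Matrix.toEuclideanLin (Matrix.diagonal a + B) θ = η • θ)
    (S : Finset (Fin N)) (R : ℝ) (hR : 0 < R)
    (hfar : ∀ τ ∈ S, R ≤ |η - a τ|) :
    ∑ τ ∈ S, (θ τ) ^ 2 ≤ M ^ 2 / R ^ 2 := by
  set T := Matrix.toEuclideanCLM (𝕜 := ℝ) B
  have hcoord : ∀ τ, (T θ) τ = (η - a τ) * θ τ := by
    intro τ
    have h := congrArg (fun v : EuclideanSpace ℝ (Fin N) => v τ) heig
    have hT : (T θ) τ = (B.mulVec θ.ofLp) τ :=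
      congrFun (Matrix.ofLp_toEuclideanCLM B θ) τ
    simp only [Matrix.toLpLin_apply, Matrix.add_mulVec, Pi.add_apply,
      Matrix.mulVec_diagonal, PiLp.smul_apply, smul_eq_mul] at h
    rw [hT]
    linarith
  have hT : ‖T θ‖ ≤ M := by
    simpa [hθ] using (T.le_of_opNorm_le hB θ)
  rw [le_div_iff₀ (by positivity), Finset.sum_mul]
  calc ∑ τ ∈ S, θ τ ^ 2 * R ^ 2 ≤ ∑ τ ∈ S, (T θ) τ ^ 2 := by
        refine Finset.sum_le_sum fun τ hτ => ?_
        have h : R ^ 2 ≤ (η - a τ) ^ 2 := by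
          rw [← sq_abs (η - a τ)]
          exact pow_le_pow_left₀ hR.le (hfar τ hτ) 2
        rw [hcoord, mul_pow, mul_comm]
        exact mul_le_mul_of_nonneg_right h (sq_nonneg _)
    _ ≤ ∑ τ, (T θ) τ ^ 2 :=
        Finset.sum_le_univ_sum_of_nonneg fun τ => sq_nonneg _
    _ = ‖T θ‖ ^ 2 := (EuclideanSpace.real_norm_sq_eq _).symm
    _ ≤ M ^ 2 := pow_le_pow_left₀ (norm_nonneg _) hT 2
end

section
/- Let δ ∈ ℝ^d be a nonzero vector and 0 < 2α₁ < α₂. For an index j ≥ 1 set j′ = l − j/2 if j is even and j′ = l + (j−1)/2 if j is odd. Then there exist c₃ > 0 and ρ₀ > 0 (depending only on |δ|, c₁, c₂, α₁, α₂) such that for every ρ ≥ ρ₀, every l ∈ ℤ with |l| ≤ c₁ρ^{α₁}, every v ∈ [0,1), every positive even integer a₁ with a₁ ≥ c₂ρ^{α₂/2}, every s ∈ {1,…,a₁/2} and every τ > a₁: | |(s′+v)δ|² − |(τ′+v)δ|² | > c₃ ρ^{α₂}. -/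
noncomputable section

theorem two_mul_abs_nIdx_le (j : ℕ) : 2 * |nIdx j| ≤ j := by
  rw [abs_eq_max_neg, nIdx]
  split_ifs <;> omega

theorem le_two_mul_abs_nIdx {a j : ℕ} (ha : Even a) (h : a < j) : (a : ℤ) ≤ 2 * |nIdx j| := by
  obtain ⟨k, rfl⟩ := ha
  rw [abs_eq_max_neg, nIdx]
  split_ifs <;> omega

open Filter in
/-- A power `x ^ p` plus a constant is eventually dominated by any positive multiple of a
strictly higher power. -/
theorem eventually_mul_rpow_add_one_le {p q : ℝ} (hp : 0 < p) (hpq : p < q) (b : ℝ) {c : ℝ}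
    (hc : 0 < c) : ∀ᶠ x : ℝ in atTop, b * x ^ p + 1 ≤ c * x ^ q := by
  filter_upwards [(tendsto_rpow_atTop (sub_pos.2 hpq)).eventually_ge_atTop ((b + 1) / c),
    (tendsto_rpow_atTop hp).eventually_ge_atTop 1, eventually_gt_atTop 0] with x h₁ h₂ hx
  have hq : x ^ q = x ^ (q - p) * x ^ p := by rw [← Real.rpow_add hx, sub_add_cancel]
  rw [div_le_iff₀ hc] at h₁
  rw [hq]
  nlinarith

/-- If `|n|` is at most `A / 4`, `|m|` is at least `A / 2`, and both are shifted by the same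
amount of size at most `A / 32`, then the squares stay separated on the scale `A ^ 2`. -/
theorem sq_div_lt_sq_sub_sq {A n m w : ℝ} (hA : 0 < A) (hn : |n| ≤ A / 4) (hm : A / 2 ≤ |m|)
    (hw : |w| ≤ A / 32) : A ^ 2 / 32 < (m + w) ^ 2 - (n + w) ^ 2 := by
  have h₁ : |n + w| ≤ 9 * A / 32 := by linarith [abs_add_le n w]
  have h₂ : 15 * A / 32 ≤ |m + w| := by
    have := abs_sub (m + w) w
    rw [add_sub_cancel_right] at this
    linarith
  rw [← sq_abs (m + w), ← sq_abs (n + w)]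
  have h₃ := pow_le_pow_left₀ (abs_nonneg _) h₁ 2
  have h₄ := pow_le_pow_left₀ (by positivity) h₂ 2
  nlinarith [pow_pos hA 2]

/-- separation of the diagonal entries `|(j′+v)δ|²` (with `j′ = l + n_j`) of the
infinite Sturm–Liouville matrix: there are `c₃ > 0`, `ρ₀ > 0` such that for `ρ ≥ ρ₀`,
`|l| ≤ c₁ρ^{α₁}`, `v ∈ [0,1)`, `a₁` a positive even integer with `a₁ ≥ c₂ρ^{α₂/2}`,
`1 ≤ s ≤ a₁/2` and `τ > a₁`, one has `||(s′+v)δ|² − |(τ′+v)δ|²| > c₃ρ^{α₂}`. -/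
theorem stmt11 (d : ℕ) (hd : 2 ≤ d) (δ : EuclideanSpace ℝ (Fin d)) (hδ : δ ≠ 0)
    (α₁ α₂ : ℝ) (hα₁ : 0 < α₁) (hα₁₂ : 2 * α₁ < α₂)
    (c₁ c₂ : ℝ) (hc₁ : 0 < c₁) (hc₂ : 0 < c₂) :
    ∃ c₃ > (0 : ℝ), ∃ ρ₀ > (0 : ℝ), ∀ ρ : ℝ, ρ₀ ≤ ρ →
      ∀ l : ℤ, (|l| : ℝ) ≤ c₁ * ρ ^ α₁ →
      ∀ v : ℝ, 0 ≤ v → v < 1 →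
      ∀ a₁ : ℕ, 0 < a₁ → Even a₁ → c₂ * ρ ^ (α₂ / 2) ≤ (a₁ : ℝ) →
      ∀ s : ℕ, 1 ≤ s → s ≤ a₁ / 2 →
      ∀ τ : ℕ, a₁ < τ →
        c₃ * ρ ^ α₂ <
          |(((l + nIdx s : ℤ) : ℝ) + v) ^ 2 * ‖δ‖ ^ 2 -
            (((l + nIdx τ : ℤ) : ℝ) + v) ^ 2 * ‖δ‖ ^ 2| := by
  have hδ' : 0 < ‖δ‖ := norm_pos_iff.2 hδ
  obtain ⟨R, hR⟩ := Filter.eventually_atTop.1 (eventually_mul_rpow_add_one_le hα₁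
    (show α₁ < α₂ / 2 by linarith) c₁ (show 0 < c₂ / 32 by positivity))
  refine ⟨c₂ ^ 2 * ‖δ‖ ^ 2 / 32, by positivity, max R 1, by positivity, ?_⟩
  intro ρ hρ l hl v hv₀ hv₁ a₁ ha₀ ha hca s _ hs τ hτ
  have hρ₀ : 0 < ρ := by linarith [le_max_right R 1]
  have hbound := hR ρ ((le_max_left R 1).trans hρ)
  have hA : (0 : ℝ) < a₁ := by exact_mod_cast ha₀
  have hw : |(l : ℝ) + v| ≤ a₁ / 32 := by
    have := abs_add_le (l : ℝ) v
    rw [abs_of_nonneg hv₀] at this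
    linarith
  have hn : |(nIdx s : ℝ)| ≤ a₁ / 4 := by
    have h : 4 * |nIdx s| ≤ a₁ := by
      have := two_mul_abs_nIdx_le s
      omega
    have h' : 4 * |(nIdx s : ℝ)| ≤ a₁ := by exact_mod_cast h
    linarith
  have hm : (a₁ : ℝ) / 2 ≤ |(nIdx τ : ℝ)| := by
    have h : (a₁ : ℝ) ≤ 2 * |(nIdx τ : ℝ)| := by exact_mod_cast le_two_mul_abs_nIdx ha hτ
    linarith
  have hsep := sq_div_lt_sq_sub_sq hA hn hm hw
  have hpow : c₂ ^ 2 * ρ ^ α₂ ≤ (a₁ : ℝ) ^ 2 := by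
    have h := pow_le_pow_left₀ (by positivity) hca 2
    rwa [mul_pow, ← Real.rpow_mul_natCast hρ₀.le, Nat.cast_ofNat,
      div_mul_cancel₀ _ (two_ne_zero' ℝ)] at h
  rw [abs_sub_comm, ← sub_mul]
  refine lt_of_lt_of_le ?_ (le_abs_self _)
  calc c₂ ^ 2 * ‖δ‖ ^ 2 / 32 * ρ ^ α₂ = c₂ ^ 2 * ρ ^ α₂ / 32 * ‖δ‖ ^ 2 := by ring
    _ ≤ (a₁ : ℝ) ^ 2 / 32 * ‖δ‖ ^ 2 := by gcongr
    _ < ((nIdx τ + (l + v)) ^ 2 - (nIdx s + (l + v)) ^ 2) * ‖δ‖ ^ 2 := by gcongr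
    _ = _ := by push_cast; ring
end
end
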